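/- Let X be a GC_n set with exactly n−1 maximal lines, where n ≥ 4, and let ℓ be an (n−1)-node line of X such that through each node of X lying on ℓ there passes exactly one maximal line of X. Then n = 4 or n = 5, and in both cases X_ℓ = ∅, i.e., no node of X uses the line ℓ. -/

import Mathlib

open MvPolynomial

/-- Bivariate real polynomials. -/
abbrev Poly2 : Type := MvPolynomial (Fin 2) ℝ

/-- Evaluation of a bivariate polynomial at a point of `ℝ²`. -/
noncomputable def evalPt (p : Poly2) (A : ℝ × ℝ) : ℝ :=
  MvPolynomial.eval (fun i => if i = 0 then A.1 else A.2) p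

/-- `X` is an `n`-poised set: it has `(n+2 choose 2)` nodes and the only polynomial of
total degree at most `n` vanishing on all of `X` is the zero polynomial. -/
def IsPoised (n : ℕ) (X : Finset (ℝ × ℝ)) : Prop :=
  X.card = (n + 2).choose 2 ∧
    ∀ p : Poly2, p.totalDegree ≤ n → (∀ A ∈ X, evalPt p A = 0) → p = 0

/-- `p` is an `n`-fundamental polynomial of the node `A` with respect to `X`. -/
def IsFund (n : ℕ) (X : Finset (ℝ × ℝ)) (A : ℝ × ℝ) (p : Poly2) : Prop :=
  p.totalDegree ≤ n ∧ evalPt p A = 1 ∧ ∀ B ∈ X, B ≠ A → evalPt p B = 0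

/-- `X` is a `GC_n` set: `n`-poised and each node has a fundamental polynomial which is
a product of `n` polynomials of degree 1. -/
def IsGC (n : ℕ) (X : Finset (ℝ × ℝ)) : Prop :=
  IsPoised n X ∧
    ∀ A ∈ X, ∃ p : Poly2, IsFund n X A p ∧
      ∃ f : Fin n → Poly2, (∀ i, (f i).totalDegree = 1) ∧ p = ∏ i, f i

/-- The nodes of `X` lying on the zero set of `ℓ`. -/
noncomputable def nodesOn (X : Finset (ℝ × ℝ)) (ℓ : Poly2) : Finset (ℝ × ℝ) :=
  @Finset.filter _ (fun A => evalPt ℓ A = 0) (Classical.decPred _) X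

/-- `ℓ` is a `k`-node line of `X`: it has degree exactly 1 and passes through exactly
`k` nodes of `X`. -/
def IsKNodeLine (X : Finset (ℝ × ℝ)) (ℓ : Poly2) (k : ℕ) : Prop :=
  ℓ.totalDegree = 1 ∧ (nodesOn X ℓ).card = k

/-- A maximal line of an `n`-poised set: an `(n+1)`-node line. -/
def IsMaximalLine (n : ℕ) (X : Finset (ℝ × ℝ)) (ℓ : Poly2) : Prop :=
  IsKNodeLine X ℓ (n + 1)

/-- The zero set of a polynomial, i.e. the line it determines when it has degree 1. -/
def zeroSet (ℓ : Poly2) : Set (ℝ × ℝ) := {A | evalPt ℓ A = 0}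

/-- `μ(X)`: the number of maximal lines (as subsets of the plane) of `X`. -/
noncomputable def mu (n : ℕ) (X : Finset (ℝ × ℝ)) : ℕ :=
  {L : Set (ℝ × ℝ) | ∃ ℓ : Poly2, IsMaximalLine n X ℓ ∧ L = zeroSet ℓ}.ncard

/-- The node `A` of `X` uses the line `ℓ`: `ℓ` divides a fundamental polynomial of `A`. -/
def Uses (n : ℕ) (X : Finset (ℝ × ℝ)) (ℓ : Poly2) (A : ℝ × ℝ) : Prop :=
  ∃ p : Poly2, IsFund n X A p ∧ ℓ ∣ p

/-- `X_ℓ`: the set of nodes of `X` using the line `ℓ`. -/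
noncomputable def usesSet (n : ℕ) (X : Finset (ℝ × ℝ)) (ℓ : Poly2) : Finset (ℝ × ℝ) :=
  @Finset.filter _ (Uses n X ℓ) (Classical.decPred _) X

/-- The Gasca–Maeztu conjecture for degree `m`: every `GC_m` set has a maximal line. -/
def GM (m : ℕ) : Prop :=
  ∀ Y : Finset (ℝ × ℝ), IsGC m Y → ∃ lam : Poly2, IsMaximalLine m Y lam

namespace GCX

open Classical in
/-- Nodes of `X` on the set `L`. -/
noncomputable def on (X : Finset (ℝ × ℝ)) (L : Set (ℝ × ℝ)) : Finset (ℝ × ℝ) :=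
  X.filter (fun A => A ∈ L)

theorem mem_on {X : Finset (ℝ × ℝ)} {L : Set (ℝ × ℝ)} {A : ℝ × ℝ} :
    A ∈ on X L ↔ A ∈ X ∧ A ∈ L := by
  classical
  simp [on]

/-- Affine lines as point sets. -/
def IsLn (L : Set (ℝ × ℝ)) : Prop :=
  ∃ a b c : ℝ, (a ≠ 0 ∨ b ≠ 0) ∧ ∀ p : ℝ × ℝ, p ∈ L ↔ a * p.1 + b * p.2 + c = 0

theorem IsLn.mem_iff {L : Set (ℝ × ℝ)} (hL : IsLn L) {p q : ℝ × ℝ} (hpq : p ≠ q)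
    (hp : p ∈ L) (hq : q ∈ L) (x : ℝ × ℝ) :
    x ∈ L ↔ (x.1 - p.1) * (q.2 - p.2) - (x.2 - p.2) * (q.1 - p.1) = 0 := by
  obtain ⟨a, b, c, hab, h⟩ := hL
  rw [h] at hp hq ⊢
  obtain ⟨p1, p2⟩ := p
  obtain ⟨q1, q2⟩ := q
  obtain ⟨x1, x2⟩ := x
  simp only [ne_eq, Prod.mk.injEq, not_and_or] at *
  have hd : a * (q1 - p1) + b * (q2 - p2) = 0 := by linear_combination hq - hp
  constructor
  · intro hx
    have hx' : a * (x1 - p1) + b * (x2 - p2) = 0 := by linear_combination hx - hp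
    rcases hab with ha | hb
    · apply mul_left_cancel₀ ha
      linear_combination (q2 - p2) * hx' - (x2 - p2) * hd
    · apply mul_left_cancel₀ hb
      linear_combination (-(q1 - p1)) * hx' + (x1 - p1) * hd
  · intro hx
    have : a * (x1 - p1) + b * (x2 - p2) = 0 := by
      rcases hpq with h1 | h1
      · have h1' : q1 - p1 ≠ 0 := fun h => h1 (by linarith)
        apply mul_left_cancel₀ h1'
        linear_combination (x1 - p1) * hd - b * hx
      · have h1' : q2 - p2 ≠ 0 := fun h => h1 (by linarith)
        apply mul_left_cancel₀ h1'
        linear_combination (x2 - p2) * hd + a * hx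
    linear_combination this + hp

theorem IsLn.eq {L K : Set (ℝ × ℝ)} (hL : IsLn L) (hK : IsLn K) {p q : ℝ × ℝ} (hpq : p ≠ q)
    (hp : p ∈ L) (hq : q ∈ L) (hp' : p ∈ K) (hq' : q ∈ K) : L = K := by
  ext x
  rw [hL.mem_iff hpq hp hq, hK.mem_iff hpq hp' hq']

theorem IsLn.param {L : Set (ℝ × ℝ)} (hL : IsLn L) {p q : ℝ × ℝ} (hpq : p ≠ q)
    (hp : p ∈ L) (hq : q ∈ L) {x : ℝ × ℝ} (hx : x ∈ L) :
    ∃ t : ℝ, x.1 = p.1 + t * (q.1 - p.1) ∧ x.2 = p.2 + t * (q.2 - p.2) := by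
  rw [hL.mem_iff hpq hp hq] at hx
  obtain ⟨p1, p2⟩ := p
  obtain ⟨q1, q2⟩ := q
  obtain ⟨x1, x2⟩ := x
  simp only [ne_eq, Prod.mk.injEq, not_and_or] at *
  rcases hpq with h1 | h1
  · have h1' : q1 - p1 ≠ 0 := fun h => h1 (by linarith)
    refine ⟨(x1 - p1) / (q1 - p1), by field_simp; ring, ?_⟩
    field_simp
    linear_combination -hx
  · have h1' : q2 - p2 ≠ 0 := fun h => h1 (by linarith)
    refine ⟨(x2 - p2) / (q2 - p2), ?_, by field_simp; ring⟩
    field_simp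
    linear_combination hx

/-- The (converse) Pappus configuration that is needed. -/
theorem pappus {D1 D2 D3 O1 O2 O3 b1 a2 A : ℝ × ℝ} {a b c t12 t13 t23 L1 L2 l : Set (ℝ × ℝ)}
    (ha : IsLn a) (hb : IsLn b) (hc : IsLn c) (h12 : IsLn t12) (h13 : IsLn t13) (h23 : IsLn t23)
    (hL1 : IsLn L1) (hL2 : IsLn L2) (hl : IsLn l)
    (aO2 : O2 ∈ a) (aO3 : O3 ∈ a) (bO1 : O1 ∈ b) (bO3 : O3 ∈ b) (cO1 : O1 ∈ c) (cO2 : O2 ∈ c)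
    (n12 : O1 ≠ O2) (n13 : O1 ≠ O3) (n23 : O2 ≠ O3) (nc : O3 ∉ c)
    (m12 : D1 ≠ D2) (m13 : D1 ≠ D3) (m23 : D2 ≠ D3)
    (t12a : D1 ∈ t12) (t12b : D2 ∈ t12) (t12c : O3 ∈ t12)
    (t13a : D1 ∈ t13) (t13b : D3 ∈ t13) (t13c : O2 ∈ t13)
    (t23a : D2 ∈ t23) (t23b : D3 ∈ t23) (t23c : O1 ∈ t23)
    (b1b : b1 ∈ b) (b1O : b1 ≠ O3) (a2a : a2 ∈ a) (a2O : a2 ≠ O3)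
    (L1a : D1 ∈ L1) (L1b : b1 ∈ L1) (L1n : D1 ≠ b1) (L1c : A ∈ L1)
    (L2a : D2 ∈ L2) (L2b : a2 ∈ L2) (L2n : D2 ≠ a2) (L2c : A ∈ L2)
    (l1 : D3 ∈ l) (l2 : b1 ∈ l) (l3 : a2 ∈ l) (ln : b1 ≠ a2) : A ∈ c := by
  obtain ⟨t, t1, t2⟩ := h12.param m12 t12a t12b t12c
  obtain ⟨u, u1, u2⟩ := h13.param m13 t13a t13b t13c
  obtain ⟨v, v1, v2⟩ := h23.param m23 t23a t23b t23c
  obtain ⟨β, β1, β2⟩ := hb.param n13 bO1 bO3 b1b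
  obtain ⟨α, α1, α2⟩ := ha.param n23 aO2 aO3 a2a
  obtain ⟨γ, γ1, γ2⟩ := hL1.param L1n L1a L1b L1c
  obtain ⟨δ, δ1, δ2⟩ := hL2.param L2n L2a L2b L2c
  rw [hl.mem_iff ln l2 l3] at l1
  rw [hc.mem_iff n12 cO1 cO2] at nc ⊢
  have hα : 1 - α ≠ 0 := by
    intro h
    have : α = 1 := by linarith
    subst this
    exact a2O (Prod.ext (by linarith) (by linarith))
  have hβ : 1 - β ≠ 0 := by
    intro h
    have : β = 1 := by linarith
    subst this
    exact b1O (Prod.ext (by linarith) (by linarith))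
  obtain ⟨D11, D12⟩ := D1
  obtain ⟨D21, D22⟩ := D2
  obtain ⟨D31, D32⟩ := D3
  obtain ⟨A1, A2⟩ := A
  obtain ⟨O11, O12⟩ := O1
  obtain ⟨O21, O22⟩ := O2
  obtain ⟨O31, O32⟩ := O3
  obtain ⟨b11, b12⟩ := b1
  obtain ⟨a21, a22⟩ := a2
  simp only at *
  subst t1 t2 u1 u2 v1 v2 β1 β2 α1 α2 γ1 γ2
  -- the area of the triangle D1 D2 D3
  obtain ⟨x1, hx1⟩ : ∃ x, x = D21 - D11 := ⟨_, rfl⟩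
  obtain ⟨x2, hx2⟩ : ∃ x, x = D22 - D12 := ⟨_, rfl⟩
  obtain ⟨y1, hy1⟩ : ∃ x, x = D31 - D11 := ⟨_, rfl⟩
  obtain ⟨y2, hy2⟩ : ∃ x, x = D32 - D12 := ⟨_, rfl⟩
  obtain rfl : D21 = D11 + x1 := by linarith
  obtain rfl : D22 = D12 + x2 := by linarith
  obtain rfl : D31 = D11 + y1 := by linarith
  obtain rfl : D32 = D12 + y2 := by linarith
  clear hx1 hx2 hy1 hy2
  have hW : x1 * y2 - x2 * y1 ≠ 0 := by
    intro hW
    apply nc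
    linear_combination ((t-1+v)*u - t*v) * hW
  have hE : γ * ((1-β)*(1-v)+β*t) - (1 - δ + δ * (α*t)) = 0 := by
    apply mul_left_cancel₀ hW
    linear_combination y2 * δ1 - y1 * δ2
  have hG : γ * ((1-β)*v) - δ * ((1-α)*u) = 0 := by
    apply mul_left_cancel₀ hW
    linear_combination x1 * δ2 - x2 * δ1
  have hC : (1-α)*(1-β)*(1-u)*(1-v) + α*(1-t)*(1-β)*(1-v) + β*t*(1-α)*(1-u) = 0 := by
    apply mul_left_cancel₀ hW
    linear_combination l1
  obtain ⟨q, hq⟩ : ∃ q, q = γ * ((1-β)*(1-v)+β*t) := ⟨_, rfl⟩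
  obtain ⟨r, hr⟩ : ∃ r, r = γ * ((1-β)*v) := ⟨_, rfl⟩
  have hp : 1 - q - r = δ * ((1-α)*(1-u)+α*(1-t)) := by linear_combination -hq - hr - hE - hG
  have hr' : r = δ * ((1-α)*u) := by linear_combination hr + hG
  have key : (1-q-r)*u*(1-v) + q*v*(1-u) - r*(1-u)*(1-v) = 0 := by
    apply mul_left_cancel₀ hα
    apply mul_left_cancel₀ hβ
    linear_combination (1-α)*(1-β)*u*(1-v)*hp + (1-α)*(1-β)*v*(1-u)*hq + r * hC
      - (1-β)*(1-v)*((1-α)*(1-u)+α*(1-t)) * hr' - (1-α)*(1-u)*((1-β)*(1-v)+β*t) * hr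
  rw [hq, hr] at key
  linear_combination (-(x1 * y2 - x2 * y1)) * key
end GCX

namespace GCX

open Classical

/-- `F` is a set of at most `n` lines covering exactly `X \ {A}`. -/
structure Cov (n : ℕ) (X : Finset (ℝ × ℝ)) (A : ℝ × ℝ) (F : Finset (Set (ℝ × ℝ))) : Prop where
  card : F.card ≤ n
  ln : ∀ L ∈ F, IsLn L
  nm : ∀ L ∈ F, A ∉ L
  cov : ∀ B ∈ X, B ≠ A → ∃ L ∈ F, B ∈ L

theorem pig {F : Finset (Set (ℝ × ℝ))} {S : Finset (ℝ × ℝ)} {L : Set (ℝ × ℝ)}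
    (hF : ∀ K ∈ F, IsLn K) (hL : IsLn L) (hS : ∀ B ∈ S, B ∈ L)
    (hc : ∀ B ∈ S, ∃ K ∈ F, B ∈ K) (hcard : F.card < S.card) : L ∈ F := by
  choose! g hg using hc
  obtain ⟨x, hx, y, hy, hxy, he⟩ :=
    Finset.exists_ne_map_eq_of_card_lt_of_maps_to hcard (fun B hB => (hg B hB).1)
  have h1 := hg x hx
  have h2 := hg y hy
  rw [← he] at h2
  rw [hL.eq (hF _ h1.1) hxy (hS x hx) (hS y hy) h1.2 h2.2]
  exact h1.1

theorem Cov.max_mem {n : ℕ} {X : Finset (ℝ × ℝ)} {A : ℝ × ℝ} {F : Finset (Set (ℝ × ℝ))}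
    (h : Cov n X A F) {L : Set (ℝ × ℝ)} (hL : IsLn L) (hc : n + 1 ≤ (on X L).card)
    (hA : A ∉ L) : L ∈ F := by
  refine pig (S := on X L) h.ln hL (fun B hB => (mem_on.1 hB).2) ?_ (by have := h.card; omega)
  intro B hB
  refine h.cov B (mem_on.1 hB).1 ?_
  rintro rfl
  exact hA (mem_on.1 hB).2

/-- The setting of the theorem in terms of point sets. -/
structure Su (n : ℕ) (X : Finset (ℝ × ℝ)) (M : Finset (Set (ℝ × ℝ))) : Prop where
  n4 : 4 ≤ n
  gc : ∀ A ∈ X, ∃ F, Cov n X A F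
  hM : ∀ L, L ∈ M ↔ IsLn L ∧ (on X L).card = n + 1
  mc : M.card = n - 1
  xc : 2 * X.card = (n + 2) * (n + 1)

variable {n : ℕ} {X : Finset (ℝ × ℝ)} {M : Finset (Set (ℝ × ℝ))}

theorem Su.ln (s : Su n X M) {L : Set (ℝ × ℝ)} (h : L ∈ M) : IsLn L := ((s.hM L).1 h).1
theorem Su.cd (s : Su n X M) {L : Set (ℝ × ℝ)} (h : L ∈ M) : (on X L).card = n + 1 :=
  ((s.hM L).1 h).2

theorem Su.card_le (s : Su n X M) {L : Set (ℝ × ℝ)} (hL : IsLn L) : (on X L).card ≤ n + 1 := by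
  by_contra hc
  push Not at hc
  obtain ⟨A, hA⟩ := Finset.card_pos.1 (by omega : 0 < (on X L).card)
  obtain ⟨hAX, hAL⟩ := mem_on.1 hA
  obtain ⟨F, hF⟩ := s.gc A hAX
  have : L ∈ F := by
    refine pig (S := (on X L).erase A) hF.ln hL ?_ ?_ ?_
    · intro B hB
      exact (mem_on.1 (Finset.mem_of_mem_erase hB)).2
    · intro B hB
      exact hF.cov B (mem_on.1 (Finset.mem_of_mem_erase hB)).1 (Finset.ne_of_mem_erase hB)
    · rw [Finset.card_erase_of_mem hA]
      have := hF.card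
      omega
  exact hF.nm L this hAL

theorem Su.meet (s : Su n X M) {L K : Set (ℝ × ℝ)} (hL : L ∈ M) (hK : K ∈ M) (hne : L ≠ K) :
    ∃ A ∈ X, A ∈ L ∧ A ∈ K := by
  by_contra hc
  push Not at hc
  have cK := s.cd hK
  obtain ⟨A, hA⟩ := Finset.card_pos.1 (by omega : 0 < (on X K).card)
  obtain ⟨hAX, hAK⟩ := mem_on.1 hA
  obtain ⟨F, hF⟩ := s.gc A hAX
  have hLF : L ∈ F := hF.max_mem (s.ln hL) (s.cd hL).ge (fun h => hc A hAX h hAK)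
  have : K ∈ F.erase L := by
    refine pig (S := (on X K).erase A) (fun J hJ => hF.ln J (Finset.mem_of_mem_erase hJ))
      (s.ln hK) ?_ ?_ ?_
    · intro B hB
      exact (mem_on.1 (Finset.mem_of_mem_erase hB)).2
    · intro B hB
      have hB' := mem_on.1 (Finset.mem_of_mem_erase hB)
      obtain ⟨J, hJ, hBJ⟩ := hF.cov B hB'.1 (Finset.ne_of_mem_erase hB)
      refine ⟨J, Finset.mem_erase.2 ⟨?_, hJ⟩, hBJ⟩
      rintro rfl
      exact hc B hB'.1 hBJ hB'.2
    · rw [Finset.card_erase_of_mem hA, Finset.card_erase_of_mem hLF]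
      have := hF.card
      have := s.n4
      omega
  exact hF.nm K (Finset.mem_of_mem_erase this) hAK

theorem Su.no3 (s : Su n X M) {L K J : Set (ℝ × ℝ)} (hL : L ∈ M) (hK : K ∈ M) (hJ : J ∈ M)
    (hLK : L ≠ K) (hLJ : L ≠ J) (hKJ : K ≠ J) {P : ℝ × ℝ} (hP : P ∈ X) (hPL : P ∈ L)
    (hPK : P ∈ K) (hPJ : P ∈ J) : False := by
  have cJ := s.cd hJ
  have n4 := s.n4
  have hPm : P ∈ on X J := mem_on.2 ⟨hP, hPJ⟩
  obtain ⟨A, hA⟩ := Finset.card_pos.1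
    (by rw [Finset.card_erase_of_mem hPm]; omega : 0 < ((on X J).erase P).card)
  have hAP := Finset.ne_of_mem_erase hA
  have hA' := Finset.mem_of_mem_erase hA
  obtain ⟨hAX, hAJ⟩ := mem_on.1 hA'
  obtain ⟨F, hF⟩ := s.gc A hAX
  have key : ∀ L ∈ M, L ≠ J → P ∈ L → ∀ B, B ≠ P → B ∈ J → B ∉ L := by
    intro L hL hLJ hPL B hBP hBJ hBL
    exact hLJ ((s.ln hL).eq (s.ln hJ) hBP hBL hPL hBJ hPJ)
  have hLF : L ∈ F := hF.max_mem (s.ln hL) (s.cd hL).ge (key L hL hLJ hPL A hAP hAJ)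
  have hKF : K ∈ F := hF.max_mem (s.ln hK) (s.cd hK).ge (key K hK hKJ hPK A hAP hAJ)
  have : J ∈ (F.erase L).erase K := by
    refine pig (S := ((on X J).erase P).erase A)
      (fun J hJ => hF.ln J (Finset.mem_of_mem_erase (Finset.mem_of_mem_erase hJ)))
      (s.ln hJ) ?_ ?_ ?_
    · intro B hB
      exact (mem_on.1 (Finset.mem_of_mem_erase (Finset.mem_of_mem_erase hB))).2
    · intro B hB
      have hB1 := Finset.ne_of_mem_erase hB
      have hB2 := Finset.ne_of_mem_erase (Finset.mem_of_mem_erase hB)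
      have hB' := mem_on.1 (Finset.mem_of_mem_erase (Finset.mem_of_mem_erase hB))
      obtain ⟨G, hG, hBG⟩ := hF.cov B hB'.1 hB1
      refine ⟨G, Finset.mem_erase.2 ⟨?_, Finset.mem_erase.2 ⟨?_, hG⟩⟩, hBG⟩
      · rintro rfl
        exact key G hK hKJ hPK B hB2 hB'.2 hBG
      · rintro rfl
        exact key G hL hLJ hPL B hB2 hB'.2 hBG
    · rw [Finset.card_erase_of_mem hA, Finset.card_erase_of_mem hPm,
        Finset.card_erase_of_mem (Finset.mem_erase.2 ⟨hLK.symm, hKF⟩),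
        Finset.card_erase_of_mem hLF]
      have := hF.card
      omega
  exact hF.nm J (Finset.mem_of_mem_erase (Finset.mem_of_mem_erase this)) hAJ

theorem Su.count (s : Su n X M) {S : Finset (Set (ℝ × ℝ))} (hS : S ⊆ M) {L : Set (ℝ × ℝ)}
    (hL : L ∈ M) (hLS : L ∉ S) :
    ((on X L).filter (fun A => ∀ K ∈ S, A ∉ K)).card + S.card = n + 1 := by
  have h : ∀ K ∈ S, ∃ A ∈ X, A ∈ L ∧ A ∈ K := fun K hK =>
    s.meet hL (hS hK) (fun h => hLS (h ▸ hK))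
  choose! g hg using h
  have e : (on X L).filter (fun A => ¬ ∀ K ∈ S, A ∉ K) = S.image g := by
    ext A
    simp only [Finset.mem_filter, mem_on, Finset.mem_image, not_forall, not_not]
    constructor
    · rintro ⟨⟨hAX, hAL⟩, K, hK, hAK⟩
      refine ⟨K, hK, ?_⟩
      by_contra hne
      obtain ⟨_, h2, h3⟩ := hg K hK
      have := (s.ln hL).eq (s.ln (hS hK)) hne h2 hAL h3 hAK
      exact hLS (this ▸ hK)
    · rintro ⟨K, hK, rfl⟩
      obtain ⟨h1, h2, h3⟩ := hg K hK
      exact ⟨⟨h1, h2⟩, K, hK, h3⟩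
  have inj : Set.InjOn g S := by
    intro K hK J hJ he
    by_contra hne
    obtain ⟨h1, h2, h3⟩ := hg K hK
    obtain ⟨h4, h5, h6⟩ := hg J hJ
    rw [← he] at h6
    exact s.no3 (hS hK) (hS hJ) hL hne (fun h => hLS (h ▸ hK)) (fun h => hLS (h ▸ hJ)) h1 h3 h6 h2
  have c := Finset.card_filter_add_card_filter_not (s := on X L) (fun A => ∀ K ∈ S, A ∉ K)
  rw [e, Finset.card_image_of_injOn inj, s.cd hL] at c
  exact c

/-- `A` is a node on `L` lying on no other line of `M`. -/
def P1 (X : Finset (ℝ × ℝ)) (M : Finset (Set (ℝ × ℝ))) (L : Set (ℝ × ℝ)) (A : ℝ × ℝ) : Prop :=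
  A ∈ X ∧ A ∈ L ∧ ∀ K ∈ M, A ∈ K → K = L

/-- `A` is a node lying on no line of `M`. -/
def P0 (X : Finset (ℝ × ℝ)) (M : Finset (Set (ℝ × ℝ))) (A : ℝ × ℝ) : Prop :=
  A ∈ X ∧ ∀ K ∈ M, A ∉ K

theorem Su.three (s : Su n X M) {L : Set (ℝ × ℝ)} (hL : L ∈ M) :
    (X.filter (P1 X M L)).card = 3 := by
  have h := s.count (Finset.erase_subset L M) hL (Finset.notMem_erase L M)
  rw [Finset.card_erase_of_mem hL, s.mc] at h
  have e : X.filter (P1 X M L) = (on X L).filter (fun A => ∀ K ∈ M.erase L, A ∉ K) := by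
    ext A
    simp only [Finset.mem_filter, mem_on, P1, Finset.mem_erase]
    constructor
    · rintro ⟨h1, _, h2, h3⟩
      exact ⟨⟨h1, h2⟩, fun K hK hA => hK.1 (h3 K hK.2 hA)⟩
    · rintro ⟨⟨h1, h2⟩, h3⟩
      refine ⟨h1, h1, h2, fun K hK hA => ?_⟩
      by_contra hne
      exact h3 K ⟨hne, hK⟩ hA
  rw [e]
  have := s.n4
  omega

theorem Su.union (s : Su n X M) (S : Finset (Set (ℝ × ℝ))) (hS : S ⊆ M) :
    2 * (X.filter (fun A => ∃ K ∈ S, A ∈ K)).card + S.card * S.card = S.card * (2 * n + 3) := by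
  induction S using Finset.induction_on with
  | empty => simp
  | insert L S hLS ih =>
    have hS' : S ⊆ M := fun x hx => hS (Finset.mem_insert_of_mem hx)
    have ih := ih hS'
    have c := s.count hS' (hS (Finset.mem_insert_self L S)) hLS
    have e : X.filter (fun A => ∃ K ∈ insert L S, A ∈ K) =
        X.filter (fun A => ∃ K ∈ S, A ∈ K) ∪ (on X L).filter (fun A => ∀ K ∈ S, A ∉ K) := by
      ext A
      simp only [Finset.mem_filter, Finset.mem_union, mem_on, Finset.mem_insert]
      constructor
      · rintro ⟨h1, K, rfl | hK, h3⟩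
        · by_cases h : ∃ J ∈ S, A ∈ J
          · exact Or.inl ⟨h1, h⟩
          · push Not at h
            exact Or.inr ⟨⟨h1, h3⟩, h⟩
        · exact Or.inl ⟨h1, K, hK, h3⟩
      · rintro (⟨h1, K, hK, h3⟩ | ⟨⟨h1, h2⟩, _⟩)
        · exact ⟨h1, K, Or.inr hK, h3⟩
        · exact ⟨h1, L, Or.inl rfl, h2⟩
    have d : Disjoint (X.filter (fun A => ∃ K ∈ S, A ∈ K))
        ((on X L).filter (fun A => ∀ K ∈ S, A ∉ K)) := by
      rw [Finset.disjoint_left]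
      intro A h1 h2
      simp only [Finset.mem_filter] at h1 h2
      obtain ⟨_, K, hK, hA⟩ := h1
      exact h2.2 K hK hA
    rw [e, Finset.card_union_of_disjoint d, Finset.card_insert_of_notMem hLS]
    nlinarith

theorem Su.zcard (s : Su n X M) : (X.filter (P0 X M)).card = 3 := by
  have u := s.union M subset_rfl
  have c := Finset.card_filter_add_card_filter_not (s := X) (fun A => ∃ K ∈ M, A ∈ K)
  have e : X.filter (fun A => ¬ ∃ K ∈ M, A ∈ K) = X.filter (P0 X M) := by
    ext A
    simp only [Finset.mem_filter, P0]
    push Not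
    tauto
  rw [e] at c
  have x := s.xc
  have n4 := s.n4
  obtain ⟨m, rfl⟩ : ∃ m, n = m + 1 := ⟨n - 1, by omega⟩
  rw [s.mc] at u
  simp only [Nat.add_sub_cancel] at u
  nlinarith

/-- residual lines after removing maximal lines -/
theorem Cov.res (s : Su n X M) {A : ℝ × ℝ} {F : Finset (Set (ℝ × ℝ))} (h : Cov n X A F)
    {B : ℝ × ℝ} (hB : B ∈ X) (hBA : B ≠ A) (hn : ∀ K ∈ M, B ∈ K → A ∈ K) :
    ∃ r ∈ F \ M, B ∈ r := by
  obtain ⟨L, hL, hBL⟩ := h.cov B hB hBA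
  exact ⟨L, Finset.mem_sdiff.2 ⟨hL, fun hLM => h.nm L hL (hn L hLM hBL)⟩, hBL⟩

theorem Cov.res_card (s : Su n X M) {A : ℝ × ℝ} {F : Finset (Set (ℝ × ℝ))} (h : Cov n X A F)
    {T : Finset (Set (ℝ × ℝ))} (hT : ∀ K ∈ M, A ∈ K → K ∈ T) : (F \ M).card ≤ 1 + T.card := by
  have h1 : M \ T ⊆ F ∩ M := by
    intro K hK
    obtain ⟨hK, hKT⟩ := Finset.mem_sdiff.1 hK
    exact Finset.mem_inter.2 ⟨h.max_mem (s.ln hK) (s.cd hK).ge (fun hA => hKT (hT K hK hA)), hK⟩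
  have h2 := Finset.card_le_card h1
  have h3 := Finset.card_sdiff_add_card_inter F M
  have h4 := Finset.le_card_sdiff T M
  have := h.card
  have := s.mc
  have := s.n4
  omega

end GCX

namespace GCX

open Classical

variable {n : ℕ} {X : Finset (ℝ × ℝ)} {M : Finset (Set (ℝ × ℝ))}
variable {O1 O2 O3 : ℝ × ℝ} {a b c : Set (ℝ × ℝ)}

theorem P1.lineEq {L K : Set (ℝ × ℝ)} {A : ℝ × ℝ} (h : P1 X M L A) (hK : K ∈ M)
    (h' : P1 X M K A) : K = L := h.2.2 K hK h'.2.1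

theorem P1.ne {L K : Set (ℝ × ℝ)} {A B : ℝ × ℝ} (h : P1 X M L A) (hK : K ∈ M)
    (h' : P1 X M K B) (hne : L ≠ K) : A ≠ B := by
  rintro rfl
  exact hne (h.lineEq hK h').symm

/-- Configuration: the three nodes outside the maximal lines, and the lines joining them. -/
structure Cfg (n : ℕ) (X : Finset (ℝ × ℝ)) (M : Finset (Set (ℝ × ℝ))) (O1 O2 O3 : ℝ × ℝ)
    (a b c : Set (ℝ × ℝ)) : Prop where
  su : Su n X M
  z : ∀ A, P0 X M A ↔ A = O1 ∨ A = O2 ∨ A = O3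
  n12 : O1 ≠ O2
  n13 : O1 ≠ O3
  n23 : O2 ≠ O3
  la : IsLn a
  lb : IsLn b
  lc : IsLn c
  aO1 : O1 ∉ a
  aO2 : O2 ∈ a
  aO3 : O3 ∈ a
  bO1 : O1 ∈ b
  bO2 : O2 ∉ b
  bO3 : O3 ∈ b
  cO1 : O1 ∈ c
  cO2 : O2 ∈ c
  cO3 : O3 ∉ c

theorem Cfg.s12 (h : Cfg n X M O1 O2 O3 a b c) : Cfg n X M O2 O1 O3 b a c :=
  ⟨h.su, fun A => by rw [h.z]; tauto, h.n12.symm, h.n23, h.n13, h.lb, h.la, h.lc,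
    h.bO2, h.bO1, h.bO3, h.aO2, h.aO1, h.aO3, h.cO2, h.cO1, h.cO3⟩

theorem Cfg.s23 (h : Cfg n X M O1 O2 O3 a b c) : Cfg n X M O1 O3 O2 a c b :=
  ⟨h.su, fun A => by rw [h.z]; tauto, h.n13, h.n12, h.n23.symm, h.la, h.lc, h.lb,
    h.aO1, h.aO3, h.aO2, h.cO1, h.cO3, h.cO2, h.bO1, h.bO3, h.bO2⟩

theorem Cfg.z1 (h : Cfg n X M O1 O2 O3 a b c) : P0 X M O1 := (h.z O1).2 (Or.inl rfl)
theorem Cfg.z2 (h : Cfg n X M O1 O2 O3 a b c) : P0 X M O2 := h.s12.z1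
theorem Cfg.z3 (h : Cfg n X M O1 O2 O3 a b c) : P0 X M O3 := h.s23.z2

theorem Su.cfg (s : Su n X M) : ∃ O1 O2 O3 a b c, Cfg n X M O1 O2 O3 a b c := by
  obtain ⟨O1, O2, O3, n12, n13, n23, e⟩ := Finset.card_eq_three.1 s.zcard
  have z : ∀ A, P0 X M A ↔ A = O1 ∨ A = O2 ∨ A = O3 := by
    intro A
    have : A ∈ X.filter (P0 X M) ↔ A = O1 ∨ A = O2 ∨ A = O3 := by rw [e]; simp
    rw [← this, Finset.mem_filter]
    exact ⟨fun h => ⟨h.1, h⟩, fun h => h.2⟩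
  have key : ∀ P Q R, P0 X M P → P0 X M Q → P0 X M R → Q ≠ P → R ≠ P →
      ∃ a, IsLn a ∧ P ∉ a ∧ Q ∈ a ∧ R ∈ a := by
    intro P Q R hP hQ hR hQP hRP
    obtain ⟨F, hF⟩ := s.gc P hP.1
    have hc := hF.res_card s (T := ∅) (fun K hK hA => absurd hA (hP.2 K hK))
    rw [Finset.card_empty, add_zero, Finset.card_le_one] at hc
    obtain ⟨r, hr, hQr⟩ := hF.res s hQ.1 hQP (fun K hK hA => absurd hA (hQ.2 K hK))
    obtain ⟨r', hr', hRr⟩ := hF.res s hR.1 hRP (fun K hK hA => absurd hA (hR.2 K hK))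
    rw [← hc r hr r' hr'] at hRr
    have := (Finset.mem_sdiff.1 hr).1
    exact ⟨r, hF.ln r this, hF.nm r this, hQr, hRr⟩
  have z1 := (z O1).2 (by simp)
  have z2 := (z O2).2 (by simp)
  have z3 := (z O3).2 (by simp)
  obtain ⟨a, a1, a2, a3, a4⟩ := key O1 O2 O3 z1 z2 z3 n12.symm n13.symm
  obtain ⟨b, b1, b2, b3, b4⟩ := key O2 O1 O3 z2 z1 z3 n12 n23.symm
  obtain ⟨c, c1, c2, c3, c4⟩ := key O3 O1 O2 z3 z1 z2 n13 n23
  exact ⟨O1, O2, O3, a, b, c, s, z, n12, n13, n23, a1, b1, c1, a2, a3, a4, b3, b2, b4, c3, c4, c2⟩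

theorem P1.ne0 {L : Set (ℝ × ℝ)} {A B : ℝ × ℝ} (h : P1 X M L A) (hL : L ∈ M)
    (hB : P0 X M B) : A ≠ B := by
  rintro rfl
  exact hB.2 L hL h.2.1

theorem Cfg.neA (h : Cfg n X M O1 O2 O3 a b c) {L : Set (ℝ × ℝ)} (hL : L ∈ M) : a ≠ L := by
  rintro rfl
  exact h.z2.2 _ hL h.aO2

theorem Cfg.ab (h : Cfg n X M O1 O2 O3 a b c) {A : ℝ × ℝ} (ha : A ∈ a) (hb : A ∈ b) : A = O3 := by
  by_contra hne
  have := h.la.eq h.lb hne ha h.aO3 hb h.bO3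
  exact h.aO1 (this ▸ h.bO1)

theorem Cfg.uniqA (h : Cfg n X M O1 O2 O3 a b c) {L : Set (ℝ × ℝ)} (hL : L ∈ M) {B C : ℝ × ℝ}
    (hB : P1 X M L B) (hC : P1 X M L C) (hBa : B ∈ a) (hCa : C ∈ a) : B = C := by
  by_contra hne
  exact h.neA hL (h.la.eq (h.su.ln hL) hne hBa hCa hB.2.1 hC.2.1)

theorem Su.get3 (s : Su n X M) {L : Set (ℝ × ℝ)} (hL : L ∈ M) :
    ∃ x y z, x ≠ y ∧ x ≠ z ∧ y ≠ z ∧ P1 X M L x ∧ P1 X M L y ∧ P1 X M L z ∧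
      ∀ B, P1 X M L B → B = x ∨ B = y ∨ B = z := by
  obtain ⟨x, y, z, n12, n13, n23, e⟩ := Finset.card_eq_three.1 (s.three hL)
  have k : ∀ A, P1 X M L A ↔ A = x ∨ A = y ∨ A = z := by
    intro A
    have : A ∈ X.filter (P1 X M L) ↔ A = x ∨ A = y ∨ A = z := by rw [e]; simp
    rw [← this, Finset.mem_filter]
    exact ⟨fun h => ⟨h.1, h⟩, fun h => h.2⟩
  exact ⟨x, y, z, n12, n13, n23, (k x).2 (by simp), (k y).2 (by simp), (k z).2 (by simp),
    fun B => (k B).1⟩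

theorem Su.third (s : Su n X M) {L : Set (ℝ × ℝ)} (hL : L ∈ M) {x y : ℝ × ℝ} (hxy : x ≠ y)
    (hx : P1 X M L x) (hy : P1 X M L y) :
    ∃ z, z ≠ x ∧ z ≠ y ∧ P1 X M L z ∧ ∀ B, P1 X M L B → B = x ∨ B = y ∨ B = z := by
  obtain ⟨p, q, r, n1, n2, n3, hp, hq, hr, e⟩ := s.get3 hL
  rcases e x hx with rfl | rfl | rfl <;> rcases e y hy with rfl | rfl | rfl
  · exact absurd rfl hxy
  · exact ⟨r, n2.symm, n3.symm, hr, e⟩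
  · exact ⟨q, n1.symm, n3, hq, fun B hB => by have := e B hB; tauto⟩
  · exact ⟨r, n3.symm, n2.symm, hr, fun B hB => by have := e B hB; tauto⟩
  · exact absurd rfl hxy
  · exact ⟨p, n1, n2, hp, fun B hB => by have := e B hB; tauto⟩
  · exact ⟨q, n3, n1.symm, hq, fun B hB => by have := e B hB; tauto⟩
  · exact ⟨p, n2, n1, hp, fun B hB => by have := e B hB; tauto⟩
  · exact absurd rfl hxy

theorem Su.exh (s : Su n X M) {L : Set (ℝ × ℝ)} (hL : L ∈ M) {x y z : ℝ × ℝ} (hxy : x ≠ y)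
    (hxz : x ≠ z) (hyz : y ≠ z)
    (hx : P1 X M L x) (hy : P1 X M L y) (hz : P1 X M L z) {B : ℝ × ℝ} (hB : P1 X M L B) :
    B = x ∨ B = y ∨ B = z := by
  obtain ⟨w, h1, h2, hw, e⟩ := s.third hL hxy hx hy
  rcases e z hz with h | h | h
  · exact absurd h.symm hxz
  · exact absurd h.symm hyz
  · rw [h]; exact e B hB

theorem two_of {R : Finset (Set (ℝ × ℝ))} (hR : R.card ≤ 2) {x y z : Set (ℝ × ℝ)} (hx : x ∈ R)
    (hy : y ∈ R) (hxy : x ≠ y) (hz : z ∈ R) : z = x ∨ z = y := by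
  by_contra hc
  push Not at hc
  have : ({z, x, y} : Finset _) ⊆ R := by
    intro w hw
    simp only [Finset.mem_insert, Finset.mem_singleton] at hw
    rcases hw with rfl | rfl | rfl <;> assumption
  have h2 := Finset.card_le_card this
  rw [Finset.card_eq_three.2 ⟨z, x, y, hc.1, hc.2, hxy, rfl⟩] at h2
  omega

theorem three_of {R : Finset (Set (ℝ × ℝ))} (hR : R.card ≤ 3) {x y z w : Set (ℝ × ℝ)} (hx : x ∈ R)
    (hy : y ∈ R) (hw : w ∈ R) (hxy : x ≠ y) (hxw : x ≠ w) (hyw : y ≠ w) (hz : z ∈ R) :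
    z = x ∨ z = y ∨ z = w := by
  have h1 : (R.erase w).card ≤ 2 := by rw [Finset.card_erase_of_mem hw]; omega
  by_cases hzw : z = w
  · exact Or.inr (Or.inr hzw)
  · have := two_of h1 (Finset.mem_erase.2 ⟨hxw, hx⟩) (Finset.mem_erase.2 ⟨hyw, hy⟩) hxy
      (Finset.mem_erase.2 ⟨hzw, hz⟩)
    tauto

theorem Cfg.G1 (h : Cfg n X M O1 O2 O3 a b c) {L : Set (ℝ × ℝ)} (hL : L ∈ M) {B C : ℝ × ℝ}
    (hB : P1 X M L B) (hC : P1 X M L C) (hne : B ≠ C) :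
    (B ∈ a ∨ B ∈ b ∨ B ∈ c) ∨ (C ∈ a ∨ C ∈ b ∨ C ∈ c) := by
  obtain ⟨A, hAB, hAC, hA, -⟩ := h.su.third hL hne hB hC
  obtain ⟨F, hF⟩ := h.su.gc A hA.1
  have hc := hF.res_card h.su (T := {L}) (fun K hK hAK => by
    rw [Finset.mem_singleton]; exact hA.2.2 K hK hAK)
  rw [Finset.card_singleton] at hc
  have cz : ∀ O, P0 X M O → ∃ r ∈ F \ M, O ∈ r := fun O hO =>
    hF.res h.su hO.1 (hA.ne0 hL hO).symm (fun K hK hA => absurd hA (hO.2 K hK))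
  have c1 : ∀ O, P1 X M L O → O ≠ A → ∃ r ∈ F \ M, O ∈ r := fun O hO hne =>
    hF.res h.su hO.1 hne (fun K hK hO' => by rw [hO.2.2 K hK hO']; exact hA.2.1)
  have ln : ∀ r ∈ F \ M, IsLn r := fun r hr => hF.ln r (Finset.mem_sdiff.1 hr).1
  obtain ⟨r, hr, hBr⟩ := c1 B hB hAB.symm
  obtain ⟨s, hs, hCs⟩ := c1 C hC hAC.symm
  have hrs : r ≠ s := by
    rintro rfl
    have := (ln r hr).eq (h.su.ln hL) hne hBr hCs hB.2.1 hC.2.1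
    exact hF.nm r (Finset.mem_sdiff.1 hr).1 (this ▸ hA.2.1)
  have co : ∀ O, P0 X M O → O ∈ r ∨ O ∈ s := by
    intro O hO
    obtain ⟨t, ht, hOt⟩ := cz O hO
    rcases two_of hc hr hs hrs ht with rfl | rfl
    · exact Or.inl hOt
    · exact Or.inr hOt
  have ea : ∀ t ∈ F \ M, O2 ∈ t → O3 ∈ t → t = a := fun t ht h2 h3 =>
    (ln t ht).eq h.la h.n23 h2 h3 h.aO2 h.aO3
  have eb : ∀ t ∈ F \ M, O1 ∈ t → O3 ∈ t → t = b := fun t ht h2 h3 =>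
    (ln t ht).eq h.lb h.n13 h2 h3 h.bO1 h.bO3
  have ec : ∀ t ∈ F \ M, O1 ∈ t → O2 ∈ t → t = c := fun t ht h2 h3 =>
    (ln t ht).eq h.lc h.n12 h2 h3 h.cO1 h.cO2
  rcases co O1 h.z1 with o1 | o1 <;> rcases co O2 h.z2 with o2 | o2
  · exact Or.inl (Or.inr (Or.inr (ec r hr o1 o2 ▸ hBr)))
  · rcases co O3 h.z3 with o3 | o3
    · exact Or.inl (Or.inr (Or.inl (eb r hr o1 o3 ▸ hBr)))
    · exact Or.inr (Or.inl (ea s hs o2 o3 ▸ hCs))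
  · rcases co O3 h.z3 with o3 | o3
    · exact Or.inl (Or.inl (ea r hr o2 o3 ▸ hBr))
    · exact Or.inr (Or.inr (Or.inl (eb s hs o1 o3 ▸ hCs)))
  · exact Or.inr (Or.inr (Or.inr (ec s hs o1 o2 ▸ hCs)))

/-- `L` has no simple node on `a`. -/
def Miss (X : Finset (ℝ × ℝ)) (M : Finset (Set (ℝ × ℝ))) (L a : Set (ℝ × ℝ)) : Prop :=
  ∀ B, P1 X M L B → B ∉ a

theorem Cfg.uniqC (h : Cfg n X M O1 O2 O3 a b c) {L : Set (ℝ × ℝ)} (hL : L ∈ M) {B C : ℝ × ℝ}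
    (hB : P1 X M L B) (hC : P1 X M L C) (hBa : B ∈ c) (hCa : C ∈ c) : B = C :=
  h.s23.s12.uniqA hL hB hC hBa hCa

theorem Cfg.uniqB (h : Cfg n X M O1 O2 O3 a b c) {L : Set (ℝ × ℝ)} (hL : L ∈ M) {B C : ℝ × ℝ}
    (hB : P1 X M L B) (hC : P1 X M L C) (hBa : B ∈ b) (hCa : C ∈ b) : B = C :=
  h.s12.uniqA hL hB hC hBa hCa

theorem Cfg.hitsB (h : Cfg n X M O1 O2 O3 a b c) {L : Set (ℝ × ℝ)} (hL : L ∈ M)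
    (hm : Miss X M L a) : ∃ B, P1 X M L B ∧ B ∈ b := by
  by_contra hc
  push Not at hc
  obtain ⟨x, y, z, n1, n2, n3, hx, hy, hz, -⟩ := h.su.get3 hL
  have k : ∀ B C, P1 X M L B → P1 X M L C → B ≠ C → B ∈ c ∨ C ∈ c := by
    intro B C hB hC hne
    have := h.G1 hL hB hC hne
    have := hm B hB
    have := hm C hC
    have := hc B hB
    have := hc C hC
    tauto
  rcases k x y hx hy n1 with h1 | h1
  · rcases k y z hy hz n3 with h2 | h2
    · exact n1 (h.uniqC hL hx hy h1 h2)
    · exact n2 (h.uniqC hL hx hz h1 h2)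
  · rcases k x z hx hz n2 with h2 | h2
    · exact n1 (h.uniqC hL hx hy h2 h1)
    · exact n3 (h.uniqC hL hy hz h1 h2)

theorem Cfg.hitsC (h : Cfg n X M O1 O2 O3 a b c) {L : Set (ℝ × ℝ)} (hL : L ∈ M)
    (hm : Miss X M L a) : ∃ B, P1 X M L B ∧ B ∈ c := h.s23.hitsB hL hm

/-- A line missing `a` and a line missing `b` are different. -/
theorem Cfg.missNe (h : Cfg n X M O1 O2 O3 a b c) {L K : Set (ℝ × ℝ)} (hL : L ∈ M)
    (hm : Miss X M L a) (hm' : Miss X M K b) : L ≠ K := by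
  rintro rfl
  obtain ⟨B, hB, hBb⟩ := h.hitsB hL hm
  exact hm' B hB hBb

/-- description of a line missing `a` -/
theorem Cfg.special (h : Cfg n X M O1 O2 O3 a b c) {L : Set (ℝ × ℝ)} (hL : L ∈ M)
    (hm : Miss X M L a) : ∃ B C D, P1 X M L B ∧ P1 X M L C ∧ P1 X M L D ∧ B ∈ b ∧ C ∈ c ∧
      D ∉ b ∧ D ∉ c ∧ B ≠ C ∧ B ≠ D ∧ C ≠ D ∧ ∀ A, P1 X M L A → A = B ∨ A = C ∨ A = D := by
  obtain ⟨B, hB, hBb⟩ := h.hitsB hL hm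
  obtain ⟨C, hC, hCc⟩ := h.hitsC hL hm
  have hBC : B ≠ C := by
    rintro rfl
    exact hB.ne0 hL h.z1 (h.s12.s23.ab hBb hCc)
  obtain ⟨D, h1, h2, hD, e⟩ := h.su.third hL hBC hB hC
  exact ⟨B, C, D, hB, hC, hD, hBb, hCc, fun hh => h1 (h.uniqB hL hD hB hh hBb),
    fun hh => h2 (h.uniqC hL hD hC hh hCc), hBC, h1.symm, h2.symm, e⟩

/-- if `L` hits all three, then its simple nodes all lie on `a ∪ b ∪ c` -/
theorem Cfg.full (h : Cfg n X M O1 O2 O3 a b c) {L : Set (ℝ × ℝ)} (hL : L ∈ M)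
    (ha : ¬ Miss X M L a) (hb : ¬ Miss X M L b) (hc : ¬ Miss X M L c) :
    ∃ A B C, P1 X M L A ∧ P1 X M L B ∧ P1 X M L C ∧ A ∈ a ∧ B ∈ b ∧ C ∈ c ∧
      A ≠ B ∧ A ≠ C ∧ B ≠ C ∧ ∀ Q, P1 X M L Q → Q = A ∨ Q = B ∨ Q = C := by
  simp only [Miss, not_forall, not_not] at ha hb hc
  obtain ⟨A, hA, hAa⟩ := ha
  obtain ⟨B, hB, hBb⟩ := hb
  obtain ⟨C, hC, hCc⟩ := hc
  have h1 : A ≠ B := by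
    rintro rfl
    exact hA.ne0 hL h.z3 (h.ab hAa hBb)
  have h2 : A ≠ C := by
    rintro rfl
    exact hA.ne0 hL h.z2 (h.s23.ab hAa hCc)
  have h3 : B ≠ C := by
    rintro rfl
    exact hB.ne0 hL h.z1 (h.s12.s23.ab hBb hCc)
  exact ⟨A, B, C, hA, hB, hC, hAa, hBb, hCc, h1, h2, h3,
    fun Q hQ => h.su.exh hL h1 h2 h3 hA hB hC hQ⟩

/-- some maximal line misses `a` -/
theorem Cfg.exMiss (h : Cfg n X M O1 O2 O3 a b c) : ∃ L ∈ M, Miss X M L a := by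
  by_contra hc
  push Not at hc
  simp only [Miss, not_forall, not_not] at hc
  choose! g hg hga using hc
  have inj : Set.InjOn g M := by
    intro L hL K hK e
    by_contra hne
    exact (hg L hL).ne hK (hg K hK) hne e
  have sub : insert O2 (insert O3 (M.image g)) ⊆ on X a := by
    intro A hA
    simp only [Finset.mem_insert, Finset.mem_image] at hA
    rw [mem_on]
    rcases hA with rfl | rfl | ⟨L, hL, rfl⟩
    · exact ⟨h.z2.1, h.aO2⟩
    · exact ⟨h.z3.1, h.aO3⟩
    · exact ⟨(hg L hL).1, hga L hL⟩
  have n3 : O3 ∉ M.image g := by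
    intro hh
    obtain ⟨L, hL, e⟩ := Finset.mem_image.1 hh
    exact (hg L hL).ne0 hL h.z3 e
  have n2 : O2 ∉ insert O3 (M.image g) := by
    intro hh
    rcases Finset.mem_insert.1 hh with hh | hh
    · exact h.n23 hh
    · obtain ⟨L, hL, e⟩ := Finset.mem_image.1 hh
      exact (hg L hL).ne0 hL h.z2 e
  have c1 := Finset.card_le_card sub
  rw [Finset.card_insert_of_notMem n2, Finset.card_insert_of_notMem n3,
    Finset.card_image_of_injOn inj, h.su.mc] at c1
  have c2 := h.su.card_le h.la
  have n4 := h.su.n4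
  have : a ∈ M := (h.su.hM a).2 ⟨h.la, by omega⟩
  exact h.neA this rfl

end GCX

namespace GCX

open Classical

variable {n : ℕ} {X : Finset (ℝ × ℝ)} {M : Finset (Set (ℝ × ℝ))}
variable {O1 O2 O3 : ℝ × ℝ} {a b c : Set (ℝ × ℝ)}

/-- residual lines for the intersection node of two maximal lines -/
structure Pair (X : Finset (ℝ × ℝ)) (M : Finset (Set (ℝ × ℝ))) (L K : Set (ℝ × ℝ))
    (R : Finset (Set (ℝ × ℝ))) : Prop where
  card : R.card ≤ 3
  ln : ∀ r ∈ R, IsLn r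
  c0 : ∀ O, P0 X M O → ∃ r ∈ R, O ∈ r
  cL : ∀ B, P1 X M L B → ∃ r ∈ R, B ∈ r
  cK : ∀ B, P1 X M K B → ∃ r ∈ R, B ∈ r
  uL : ∀ r ∈ R, ∀ B C, P1 X M L B → P1 X M L C → B ∈ r → C ∈ r → B = C
  uK : ∀ r ∈ R, ∀ B C, P1 X M K B → P1 X M K C → B ∈ r → C ∈ r → B = C

theorem Pair.symm {L K : Set (ℝ × ℝ)} {R : Finset (Set (ℝ × ℝ))} (p : Pair X M L K R) :
    Pair X M K L R := ⟨p.card, p.ln, p.c0, p.cK, p.cL, p.uK, p.uL⟩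

theorem Cov.pair (s : Su n X M) {A : ℝ × ℝ} {F : Finset (Set (ℝ × ℝ))} (h : Cov n X A F)
    (hA : A ∈ X) {L K : Set (ℝ × ℝ)} (hL : L ∈ M) (hK : K ∈ M) (hne : L ≠ K) (hAL : A ∈ L)
    (hAK : A ∈ K) : Pair X M L K (F \ M) := by
  have key : ∀ L K, L ∈ M → K ∈ M → L ≠ K → A ∈ L → A ∈ K → ∀ B, P1 X M L B → B ≠ A := by
    rintro L K hL hK hne hAL hAK B hB rfl
    exact hne (hB.2.2 K hK hAK).symm
  have k2 : ∀ L, L ∈ M → A ∈ L → ∀ r ∈ F \ M, ∀ B C, P1 X M L B → P1 X M L C →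
      B ∈ r → C ∈ r → B = C := by
    intro L hL hAL r hr B C hB hC hBr hCr
    by_contra hn
    have hr' := (Finset.mem_sdiff.1 hr).1
    exact h.nm r hr' ((h.ln r hr').eq (s.ln hL) hn hBr hCr hB.2.1 hC.2.1 ▸ hAL)
  refine ⟨?_, fun r hr => h.ln r (Finset.mem_sdiff.1 hr).1, ?_, ?_, ?_, k2 L hL hAL, k2 K hK hAK⟩
  · have := h.res_card s (T := {L, K}) (by
      intro J hJ hAJ
      by_contra hc
      simp only [Finset.mem_insert, Finset.mem_singleton, not_or] at hc
      exact s.no3 hL hK hJ hne (Ne.symm hc.1) (Ne.symm hc.2) hA hAL hAK hAJ)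
    rw [Finset.card_pair hne] at this
    exact this
  · intro O hO
    refine h.res s hO.1 ?_ (fun J hJ hOJ => absurd hOJ (hO.2 J hJ))
    rintro rfl
    exact hO.2 L hL hAL
  · intro B hB
    refine h.res s hB.1 (key L K hL hK hne hAL hAK B hB) ?_
    intro J hJ hBJ
    rw [hB.2.2 J hJ hBJ]
    exact hAL
  · intro B hB
    refine h.res s hB.1 (key K L hK hL hne.symm hAK hAL B hB) ?_
    intro J hJ hBJ
    rw [hB.2.2 J hJ hBJ]
    exact hAK

theorem Pair.exL (s : Su n X M) {L K : Set (ℝ × ℝ)} {R : Finset (Set (ℝ × ℝ))}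
    (p : Pair X M L K R) (hL : L ∈ M) {r : Set (ℝ × ℝ)} (hr : r ∈ R) :
    ∃ B, P1 X M L B ∧ B ∈ r := by
  have hc := p.cL
  choose! g hg hgm using hc
  have hf : ∀ B ∈ X.filter (P1 X M L), P1 X M L B := fun B hB => (Finset.mem_filter.1 hB).2
  have h1 : Set.MapsTo g (X.filter (P1 X M L) : Finset _) R := fun B hB => hg B (hf B hB)
  have h2 : Set.InjOn g (X.filter (P1 X M L) : Finset _) := by
    intro B hB C hC e
    have hB := hf B hB
    have hC := hf C hC
    exact p.uL _ (hg B hB) B C hB hC (hgm B hB) (e ▸ hgm C hC)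
  have h3 := Finset.surjOn_of_injOn_of_card_le g h1 h2 (by rw [s.three hL]; exact p.card)
  obtain ⟨B, hB, e⟩ := h3 hr
  exact ⟨B, hf B hB, e ▸ hgm B (hf B hB)⟩

theorem Pair.lineL (s : Su n X M) {L K : Set (ℝ × ℝ)} {R : Finset (Set (ℝ × ℝ))}
    (p : Pair X M L K R) (hL : L ∈ M) {r r' : Set (ℝ × ℝ)} (hr : r ∈ R) (hr' : r' ∈ R)
    {B : ℝ × ℝ} (hB : P1 X M L B) (hBr : B ∈ r) (hBr' : B ∈ r') : r = r' := by
  have hc : ∀ r ∈ R, ∃ B, P1 X M L B ∧ B ∈ r := fun r hr => p.exL s hL hr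
  choose! g hg hgm using hc
  have h1 : Set.MapsTo g R (X.filter (P1 X M L) : Finset _) := fun r hr => by
    simp only [Finset.coe_filter, Set.mem_ofPred_eq]
    exact ⟨(hg r hr).1, hg r hr⟩
  have h2 : Set.SurjOn g R (X.filter (P1 X M L) : Finset _) := by
    intro C hC
    have hC : P1 X M L C := (Finset.mem_filter.1 hC).2
    obtain ⟨t, ht, hCt⟩ := p.cL C hC
    exact ⟨t, ht, p.uL t ht _ _ (hg t ht) hC (hgm t ht) hCt⟩
  have h3 := Finset.injOn_of_surjOn_of_card_le g h1 h2 (by rw [s.three hL]; exact p.card)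
  exact h3 hr hr' ((p.uL r hr _ _ (hg r hr) hB (hgm r hr) hBr).trans
    (p.uL r' hr' _ _ (hg r' hr') hB (hgm r' hr') hBr').symm)

theorem Cfg.G5a (h : Cfg n X M O1 O2 O3 a b c) {L K : Set (ℝ × ℝ)} {R : Finset (Set (ℝ × ℝ))}
    (p : Pair X M L K R) (hL : L ∈ M) (hm : Miss X M L a) (hb : b ∉ R) (hc : c ∉ R)
    {C r : _} (hC : P1 X M L C) (hCc : C ∈ c) (hr : r ∈ R) (hO : O3 ∈ r) : C ∈ r := by
  obtain ⟨B, C', D, hB, hC', hD, hBb, hCc', hDb, hDc, n1, n2, n3, e⟩ := h.special hL hm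
  obtain rfl := h.uniqC hL hC hC' hCc hCc'
  obtain ⟨Q, hQ, hQr⟩ := p.exL h.su hL hr
  rcases e Q hQ with rfl | rfl | rfl
  · exact absurd ((p.ln r hr).eq h.lb (hQ.ne0 hL h.z3) hQr hO hBb h.bO3 ▸ hr) hb
  · exact hQr
  · exfalso
    obtain ⟨t, ht, h1t⟩ := p.c0 O1 h.z1
    obtain ⟨P, hP, hPt⟩ := p.exL h.su hL ht
    rcases e P hP with rfl | rfl | rfl
    · exact absurd ((p.ln t ht).eq h.lb (hP.ne0 hL h.z1) hPt h1t hBb h.bO1 ▸ ht) hb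
    · exact absurd ((p.ln t ht).eq h.lc (hP.ne0 hL h.z1) hPt h1t hCc h.cO1 ▸ ht) hc
    · obtain rfl := p.lineL h.su hL hr ht hQ hQr hPt
      have := (p.ln r hr).eq h.lb h.n13 h1t hO h.bO1 h.bO3
      exact hDb (this ▸ hQr)

/-- Structure of the residual lines when `L` misses `a` and `K` misses `b`. -/
theorem Cfg.G5 (h : Cfg n X M O1 O2 O3 a b c) {L K : Set (ℝ × ℝ)} {R : Finset (Set (ℝ × ℝ))}
    (p : Pair X M L K R) (hL : L ∈ M) (hK : K ∈ M) (hm : Miss X M L a) (hm' : Miss X M K b) :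
    (∀ D1 D2, P1 X M L D1 → D1 ∉ b → D1 ∉ c → P1 X M K D2 → D2 ∉ a → D2 ∉ c →
      ∃ t, IsLn t ∧ D1 ∈ t ∧ D2 ∈ t ∧ O3 ∈ t) ∧
    (∀ s ∈ R, O1 ∉ s → O3 ∉ s → (∃ B, P1 X M L B ∧ B ∈ b ∧ B ∈ s) ∧
      (∃ A, P1 X M K A ∧ A ∈ a ∧ A ∈ s)) := by
  have hb : b ∉ R := fun hb => by
    obtain ⟨B, hB, hBb⟩ := p.symm.exL h.su hK hb
    exact hm' B hB hBb
  have ha : a ∉ R := fun ha => by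
    obtain ⟨B, hB, hBb⟩ := p.exL h.su hL ha
    exact hm B hB hBb
  obtain ⟨B1, C1, D1, hB1, hC1, hD1, hBb, hCc, hDb, hDc, n1, n2, n3, e⟩ := h.special hL hm
  obtain ⟨A2, C2, D2, hA2, hC2, hD2, hAa, hCc2, hDa2, hDc2, m1, m2, m3, e2⟩ :=
    h.s12.special hK hm'
  obtain ⟨r, hr, hOr⟩ := p.c0 O3 h.z3
  have hLK := h.missNe hL hm hm'
  have hc : c ∈ R := by
    by_contra hc
    have h1 := h.G5a p hL hm hb hc hC1 hCc hr hOr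
    have h2 := h.s12.G5a p.symm hK hm' ha hc hC2 hCc2 hr hOr
    exact hc ((p.ln r hr).eq h.lc (hC1.ne hK hC2 hLK) h1 h2 hCc hCc2 ▸ hr)
  have hrc : r ≠ c := by
    rintro rfl
    exact h.cO3 hOr
  have r1 : D1 ∈ r := by
    obtain ⟨Q, hQ, hQr⟩ := p.exL h.su hL hr
    rcases e Q hQ with rfl | rfl | rfl
    · exact absurd ((p.ln r hr).eq h.lb (hQ.ne0 hL h.z3) hQr hOr hBb h.bO3 ▸ hr) hb
    · exact absurd (p.lineL h.su hL hr hc hQ hQr hCc) hrc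
    · exact hQr
  have r2 : D2 ∈ r := by
    obtain ⟨Q, hQ, hQr⟩ := p.symm.exL h.su hK hr
    rcases e2 Q hQ with rfl | rfl | rfl
    · exact absurd ((p.ln r hr).eq h.la (hQ.ne0 hK h.z3) hQr hOr hAa h.aO3 ▸ hr) ha
    · exact absurd (p.symm.lineL h.su hK hr hc hQ hQr hCc2) hrc
    · exact hQr
  constructor
  · intro E1 E2 hE1 x1 x2 hE2 y1 y2
    have f1 : E1 = D1 := by
      rcases e E1 hE1 with rfl | rfl | rfl
      · exact absurd hBb x1
      · exact absurd hCc x2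
      · rfl
    have f2 : E2 = D2 := by
      rcases e2 E2 hE2 with rfl | rfl | rfl
      · exact absurd hAa y1
      · exact absurd hCc2 y2
      · rfl
    subst f1 f2
    exact ⟨r, p.ln r hr, r1, r2, hOr⟩
  · intro s hs h1 h3
    have sc : s ≠ c := by
      rintro rfl
      exact h1 h.cO1
    have sr : s ≠ r := by
      rintro rfl
      exact h3 hOr
    constructor
    · obtain ⟨Q, hQ, hQr⟩ := p.exL h.su hL hs
      rcases e Q hQ with rfl | rfl | rfl
      · exact ⟨Q, hQ, hBb, hQr⟩
      · exact absurd (p.lineL h.su hL hs hc hQ hQr hCc) sc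
      · exact absurd (p.lineL h.su hL hs hr hQ hQr r1) sr
    · obtain ⟨Q, hQ, hQr⟩ := p.symm.exL h.su hK hs
      rcases e2 Q hQ with rfl | rfl | rfl
      · exact ⟨Q, hQ, hAa, hQr⟩
      · exact absurd (p.symm.lineL h.su hK hs hc hQ hQr hCc2) sc
      · exact absurd (p.symm.lineL h.su hK hs hr hQ hQr r2) sr

theorem Cfg.tline (h : Cfg n X M O1 O2 O3 a b c) {L K : Set (ℝ × ℝ)}
    (hL : L ∈ M) (hK : K ∈ M) (hm : Miss X M L a) (hm' : Miss X M K b) {D1 D2 : ℝ × ℝ}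
    (hD1 : P1 X M L D1) (h1 : D1 ∉ b) (h2 : D1 ∉ c) (hD2 : P1 X M K D2) (h3 : D2 ∉ a)
    (h4 : D2 ∉ c) : ∃ t, IsLn t ∧ D1 ∈ t ∧ D2 ∈ t ∧ O3 ∈ t := by
  have hne := h.missNe hL hm hm'
  obtain ⟨A, hA, hAL, hAK⟩ := h.su.meet hL hK hne
  obtain ⟨F, hF⟩ := h.su.gc A hA
  exact (h.G5 (hF.pair h.su hA hL hK hne hAL hAK) hL hK hm hm').1 D1 D2 hD1 h1 h2 hD2 h3 h4

/-- only one maximal line misses `a` -/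
theorem Cfg.missUniq (h : Cfg n X M O1 O2 O3 a b c) {L L' : Set (ℝ × ℝ)}
    (hL : L ∈ M) (hL' : L' ∈ M) (hm : Miss X M L a) (hm' : Miss X M L' a) : L = L' := by
  by_contra hne
  obtain ⟨K, hK, hKm⟩ := h.s12.exMiss
  obtain ⟨J, hJ, hJm⟩ := h.s23.s12.exMiss
  obtain ⟨B1, C1, D1, hB1, hC1, hD1, hBb, hCc, hDb, hDc, -⟩ := h.special hL hm
  obtain ⟨B1', C1', D1', hB1', hC1', hD1', hBb', hCc', hDb', hDc', -⟩ := h.special hL' hm'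
  obtain ⟨A2, C2, D2, -, -, hD2, -, -, hDa2, hDc2, -⟩ := h.s12.special hK hKm
  obtain ⟨A3, B3, D3, -, -, hD3, -, -, hDa3, hDb3, -⟩ := h.s23.s12.special hJ hJm
  obtain ⟨t, t0, t1, t2, t3⟩ := h.tline hL hK hm hKm hD1 hDb hDc hD2 hDa2 hDc2
  obtain ⟨u, u0, u1, u2, u3⟩ := h.tline hL' hK hm' hKm hD1' hDb' hDc' hD2 hDa2 hDc2
  obtain ⟨v, v0, v1, v2, v3⟩ := h.s23.tline hL hJ hm hJm hD1 hDc hDb hD3 hDa3 hDb3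
  obtain ⟨w, w0, w1, w2, w3⟩ := h.s23.tline hL' hJ hm' hJm hD1' hDc' hDb' hD3 hDa3 hDb3
  have d := hD1.ne hL' hD1' hne
  obtain rfl := t0.eq u0 (hD2.ne0 hK h.z3) t2 t3 u2 u3
  obtain rfl := v0.eq w0 (hD3.ne0 hJ h.z2) v2 v3 w2 w3
  obtain rfl := t0.eq v0 d t1 u1 v1 w1
  have := t0.eq h.la h.n23 v3 t3 h.aO2 h.aO3
  exact hm D1 hD1 (this ▸ t1)

/-- The line `l` of the theorem. -/
structure Ell (n : ℕ) (X : Finset (ℝ × ℝ)) (M : Finset (Set (ℝ × ℝ))) (l : Set (ℝ × ℝ)) :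
    Prop where
  ln : IsLn l
  card : (on X l).card = n - 1
  one : ∀ A ∈ X, A ∈ l → ∃ L ∈ M, P1 X M L A

theorem Ell.notM (s : Su n X M) {l : Set (ℝ × ℝ)} (e : Ell n X M l) : l ∉ M := by
  intro h
  have := s.cd h
  have := e.card
  omega

theorem Ell.no0 {l : Set (ℝ × ℝ)} (e : Ell n X M l) {O : ℝ × ℝ} (hO : P0 X M O) : O ∉ l := by
  intro h
  obtain ⟨L, hL, hO'⟩ := e.one O hO.1 h
  exact hO.2 L hL hO'.2.1

theorem Ell.uniq (s : Su n X M) {l : Set (ℝ × ℝ)} (e : Ell n X M l) {L : Set (ℝ × ℝ)} (hL : L ∈ M)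
    {A B : ℝ × ℝ} (hA : A ∈ l) (hB : B ∈ l) (hAL : A ∈ L) (hBL : B ∈ L) : A = B := by
  by_contra hne
  exact e.notM s (e.ln.eq (s.ln hL) hne hA hB hAL hBL ▸ hL)

theorem Ell.ex (s : Su n X M) {l : Set (ℝ × ℝ)} (e : Ell n X M l) {L : Set (ℝ × ℝ)} (hL : L ∈ M) :
    ∃ A, A ∈ l ∧ P1 X M L A := by
  have h : ∀ A ∈ on X l, ∃ L ∈ M, P1 X M L A := fun A hA =>
    e.one A (mem_on.1 hA).1 (mem_on.1 hA).2
  choose! g hg hg1 using h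
  have h2 : Set.InjOn g (on X l) := by
    intro A hA B hB he
    have h1 := (hg1 A hA).2.1
    have h2 := (hg1 B hB).2.1
    rw [← he] at h2
    exact e.uniq s (hg A hA) (mem_on.1 hA).2 (mem_on.1 hB).2 h1 h2
  have h3 := Finset.surjOn_of_injOn_of_card_le g (fun A hA => hg A hA) h2
    (by rw [s.mc, e.card])
  obtain ⟨A, hA, rfl⟩ := h3 hL
  exact ⟨A, (mem_on.1 hA).2, hg1 A hA⟩

/-- at most one node of `l` on `a` -/
theorem Cfg.ellA (h : Cfg n X M O1 O2 O3 a b c) {l : Set (ℝ × ℝ)} (e : Ell n X M l) {A B : ℝ × ℝ}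
    (hA : A ∈ l) (hB : B ∈ l) (hAa : A ∈ a) (hBa : B ∈ a) : A = B := by
  by_contra hne
  exact e.no0 h.z2 (e.ln.eq h.la hne hA hB hAa hBa ▸ h.aO2)

theorem Cfg.ellD (h : Cfg n X M O1 O2 O3 a b c) {l : Set (ℝ × ℝ)} (e : Ell n X M l) {L K : _}
    (hL : L ∈ M) (hK : K ∈ M) (hm : Miss X M L a) (hm' : Miss X M K b) {D1 D2 : ℝ × ℝ}
    (hD1 : P1 X M L D1) (h1 : D1 ∉ b) (h2 : D1 ∉ c) (hD2 : P1 X M K D2) (h3 : D2 ∉ a)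
    (h4 : D2 ∉ c) (l1 : D1 ∈ l) (l2 : D2 ∈ l) : False := by
  obtain ⟨t, t0, t1, t2, t3⟩ := h.tline hL hK hm hm' hD1 h1 h2 hD2 h3 h4
  have := t0.eq e.ln (hD1.ne hK hD2 (h.missNe hL hm hm')) t1 t2 l1 l2
  exact e.no0 h.z3 (this ▸ t3)

theorem Cfg.missOf (h : Cfg n X M O1 O2 O3 a b c) {L : Set (ℝ × ℝ)} (hL : L ∈ M) {D : ℝ × ℝ}
    (hD : P1 X M L D) (ha : D ∉ a) (hb : D ∉ b) (hc : D ∉ c) :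
    Miss X M L a ∨ Miss X M L b ∨ Miss X M L c := by
  by_contra hn
  push Not at hn
  obtain ⟨A, B, C, -, -, -, hA, hB, hC, -, -, -, e⟩ := h.full hL hn.1 hn.2.1 hn.2.2
  rcases e D hD with rfl | rfl | rfl
  · exact ha hA
  · exact hb hB
  · exact hc hC

theorem Cfg.restOne (h : Cfg n X M O1 O2 O3 a b c) {l : Set (ℝ × ℝ)} (e : Ell n X M l)
    {D E : ℝ × ℝ} (hD : D ∈ X) (hE : E ∈ X) (hDl : D ∈ l) (hEl : E ∈ l)
    (d1 : D ∉ a) (d2 : D ∉ b) (d3 : D ∉ c) (e1 : E ∉ a) (e2 : E ∉ b) (e3 : E ∉ c) : D = E := by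
  obtain ⟨L, hL, hD⟩ := e.one D hD hDl
  obtain ⟨K, hK, hE⟩ := e.one E hE hEl
  have same : L = K → D = E := by
    rintro rfl
    exact e.uniq h.su hL hDl hEl hD.2.1 hE.2.1
  rcases h.missOf hL hD d1 d2 d3 with m | m | m <;> rcases h.missOf hK hE e1 e2 e3 with k | k | k
  · exact same (h.missUniq hL hK m k)
  · exact (h.ellD e hL hK m k hD d2 d3 hE e1 e3 hDl hEl).elim
  · exact (h.s23.ellD e hL hK m k hD d3 d2 hE e1 e2 hDl hEl).elim
  · exact (h.ellD e hK hL k m hE e2 e3 hD d1 d3 hEl hDl).elim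
  · exact same (h.s12.missUniq hL hK m k)
  · exact (h.s12.s23.ellD e hL hK m k hD d3 d1 hE e2 e1 hDl hEl).elim
  · exact (h.s23.ellD e hK hL k m hE e3 e2 hD d1 d2 hEl hDl).elim
  · exact (h.s12.s23.ellD e hK hL k m hE e3 e1 hD d2 d1 hEl hDl).elim
  · exact same (h.s23.s12.missUniq hL hK m k)

theorem Cfg.le5 (h : Cfg n X M O1 O2 O3 a b c) {l : Set (ℝ × ℝ)} (e : Ell n X M l) : n ≤ 5 := by
  obtain ⟨Q, hQ⟩ : ∃ Q : ℝ × ℝ → Prop, ∀ A, Q A ↔ (A ∉ a ∧ A ∉ b ∧ A ∉ c) :=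
    ⟨_, fun _ => Iff.rfl⟩
  have c1 : ∀ Q : (ℝ × ℝ) → Prop, (∀ A ∈ X, ∀ B ∈ X, A ∈ l → B ∈ l → Q A → Q B → A = B) →
      ((on X l).filter Q).card ≤ 1 := by
    intro Q hQ
    rw [Finset.card_le_one]
    intro A hA B hB
    simp only [Finset.mem_filter, mem_on] at hA hB
    exact hQ A hA.1.1 B hB.1.1 hA.1.2 hB.1.2 hA.2 hB.2
  have qa := c1 (fun A => A ∈ a) (fun A _ B _ h1 h2 h3 h4 => h.ellA e h1 h2 h3 h4)
  have qb := c1 (fun A => A ∈ b) (fun A _ B _ h1 h2 h3 h4 => h.s12.ellA e h1 h2 h3 h4)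
  have qc := c1 (fun A => A ∈ c) (fun A _ B _ h1 h2 h3 h4 => h.s23.s12.ellA e h1 h2 h3 h4)
  have qd := c1 Q (fun A hA B hB h1 h2 h3 h4 =>
    h.restOne e hA hB h1 h2 ((hQ A).1 h3).1 ((hQ A).1 h3).2.1 ((hQ A).1 h3).2.2
      ((hQ B).1 h4).1 ((hQ B).1 h4).2.1 ((hQ B).1 h4).2.2)
  have sub : on X l ⊆ (((on X l).filter (fun A => A ∈ a) ∪ (on X l).filter (fun A => A ∈ b)) ∪
      (on X l).filter (fun A => A ∈ c)) ∪
      (on X l).filter Q := by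
    intro A hA
    simp only [Finset.mem_union, Finset.mem_filter, hA, true_and, hQ]
    tauto
  have k0 := Finset.card_le_card sub
  have k1 := Finset.card_union_le (((on X l).filter (fun A => A ∈ a) ∪
    (on X l).filter (fun A => A ∈ b)) ∪ (on X l).filter (fun A => A ∈ c))
    ((on X l).filter Q)
  have k2 := Finset.card_union_le ((on X l).filter (fun A => A ∈ a) ∪
    (on X l).filter (fun A => A ∈ b)) ((on X l).filter (fun A => A ∈ c))
  have k3 := Finset.card_union_le ((on X l).filter (fun A => A ∈ a))
    ((on X l).filter (fun A => A ∈ b))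
  have := e.card
  omega

/-- The Pappus obstruction. -/
theorem Cfg.pap (h : Cfg n X M O1 O2 O3 a b c) {l : Set (ℝ × ℝ)} (e : Ell n X M l)
    {L K J : Set (ℝ × ℝ)} (hL : L ∈ M) (hK : K ∈ M) (hJ : J ∈ M)
    (mL : Miss X M L a) (mK : Miss X M K b) (mJ : Miss X M J c) {B1 A2 D3 : ℝ × ℝ}
    (hB1 : P1 X M L B1) (B1b : B1 ∈ b) (B1l : B1 ∈ l)
    (hA2 : P1 X M K A2) (A2a : A2 ∈ a) (A2l : A2 ∈ l)
    (hD3 : P1 X M J D3) (D3a : D3 ∉ a) (D3b : D3 ∉ b) (D3l : D3 ∈ l) : False := by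
  obtain ⟨B, C, D1, hB, hC, hD1, Bb, Cc, D1b, D1c, -, ne1, -, -⟩ := h.special hL mL
  obtain rfl := h.uniqB hL hB1 hB B1b Bb
  obtain ⟨A, C2, D2, hA, -, hD2, Aa, -, D2a, D2c, -, ne2, -, -⟩ := h.s12.special hK mK
  obtain rfl := h.uniqA hK hA2 hA A2a Aa
  have nLK := h.missNe hL mL mK
  have nLJ := h.s23.missNe hL mL mJ
  have nKJ := h.s12.s23.missNe hK mK mJ
  obtain ⟨t, t0, t1, t2, t3⟩ := h.tline hL hK mL mK hD1 D1b D1c hD2 D2a D2c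
  obtain ⟨u, u0, u1, u2, u3⟩ := h.s23.tline hL hJ mL mJ hD1 D1c D1b hD3 D3a D3b
  obtain ⟨v, v0, v1, v2, v3⟩ := h.s12.s23.tline hK hJ mK mJ hD2 D2c D2a hD3 D3b D3a
  obtain ⟨P, hP, PL, PK⟩ := h.su.meet hL hK nLK
  have hPc : P ∈ c := pappus h.la h.lb h.lc t0 u0 v0 (h.su.ln hL) (h.su.ln hK) e.ln
    h.aO2 h.aO3 h.bO1 h.bO3 h.cO1 h.cO2 h.n12 h.n13 h.n23 h.cO3
    (hD1.ne hK hD2 nLK) (hD1.ne hJ hD3 nLJ) (hD2.ne hJ hD3 nKJ)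
    t1 t2 t3 u1 u2 u3 v1 v2 v3 B1b (hB1.ne0 hL h.z3) A2a (hA2.ne0 hK h.z3)
    hD1.2.1 hB1.2.1 ne1.symm PL hD2.2.1 hA2.2.1 ne2.symm PK D3l B1l A2l (hB1.ne hK hA2 nLK)
  have : C ≠ P := by
    rintro rfl
    exact nLK (hC.2.2 K hK PK).symm
  exact h.s23.s12.neA hL (h.lc.eq (h.su.ln hL) this Cc hPc hC.2.1 PL)

/-- used by the intersection of two special lines: impossible -/
theorem Cfg.useSS (h : Cfg n X M O1 O2 O3 a b c) {l : Set (ℝ × ℝ)} (e : Ell n X M l)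
    {L K : Set (ℝ × ℝ)} {R : _} (p : Pair X M L K R) (hlR : l ∈ R) (hL : L ∈ M) (hK : K ∈ M)
    (mL : Miss X M L a) (mK : Miss X M K b) : False := by
  obtain ⟨⟨B1, hB1, B1b, B1l⟩, ⟨A2, hA2, A2a, A2l⟩⟩ :=
    (h.G5 p hL hK mL mK).2 l hlR (e.no0 h.z1) (e.no0 h.z3)
  obtain ⟨J, hJ, mJ⟩ := h.s23.s12.exMiss
  obtain ⟨D3, D3l, hD3⟩ := e.ex h.su hJ
  have nLJ := h.s23.missNe hL mL mJ
  have nKJ := h.s12.s23.missNe hK mK mJ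
  refine h.pap e hL hK hJ mL mK mJ hB1 B1b B1l hA2 A2a A2l hD3 ?_ ?_ D3l
  · intro hh
    exact hA2.ne hJ hD3 nKJ (h.ellA e A2l D3l A2a hh)
  · intro hh
    exact hB1.ne hJ hD3 nLJ (h.s12.ellA e B1l D3l B1b hh)

/-- used by a node on a full line whose node on `l` lies on `c` : impossible -/
theorem Cfg.useF (h : Cfg n X M O1 O2 O3 a b c) {l : Set (ℝ × ℝ)} (e : Ell n X M l)
    {L K : Set (ℝ × ℝ)} {R : _} (p : Pair X M L K R) (hlR : l ∈ R) (hL : L ∈ M) (hK : K ∈ M)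
    (hLK : L ≠ K) {A B C : ℝ × ℝ} (hA : P1 X M L A) (hB : P1 X M L B) (hC : P1 X M L C)
    (Aa : A ∈ a) (Bb : B ∈ b) (Cc : C ∈ c) (nAB : A ≠ B) (nAC : A ≠ C) (nBC : B ≠ C)
    (Cl : C ∈ l) : False := by
  obtain ⟨r, hr, Ar⟩ := p.cL A hA
  obtain ⟨s, hs, Bs⟩ := p.cL B hB
  have nrs : r ≠ s := by
    rintro rfl
    exact nAB (p.uL r hr A B hA hB Ar Bs)
  have nrl : r ≠ l := by
    rintro rfl
    exact nAC (p.uL r hr A C hA hC Ar Cl)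
  have nsl : s ≠ l := by
    rintro rfl
    exact nBC (p.uL s hs B C hB hC Bs Cl)
  have co : ∀ O, P0 X M O → O ∈ r ∨ O ∈ s := by
    intro O hO
    obtain ⟨t, ht, hOt⟩ := p.c0 O hO
    rcases three_of p.card hr hs hlR nrs nrl nsl ht with rfl | rfl | rfl
    · exact Or.inl hOt
    · exact Or.inr hOt
    · exact absurd hOt (e.no0 hO)
  have ra2 : O2 ∈ r → r = a := fun hh =>
    (p.ln r hr).eq h.la (hA.ne0 hL h.z2) Ar hh Aa h.aO2
  have ra3 : O3 ∈ r → r = a := fun hh =>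
    (p.ln r hr).eq h.la (hA.ne0 hL h.z3) Ar hh Aa h.aO3
  have sb1 : O1 ∈ s → s = b := fun hh =>
    (p.ln s hs).eq h.lb (hB.ne0 hL h.z1) Bs hh Bb h.bO1
  have sb3 : O3 ∈ s → s = b := fun hh =>
    (p.ln s hs).eq h.lb (hB.ne0 hL h.z3) Bs hh Bb h.bO3
  have ra : r = a := by
    rcases co O3 h.z3 with h3 | h3
    · exact ra3 h3
    · rcases co O2 h.z2 with h2 | h2
      · exact ra2 h2
      · exact absurd (sb3 h3 ▸ h2) h.bO2
  have sb : s = b := by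
    rcases co O3 h.z3 with h3 | h3
    · rcases co O1 h.z1 with h1 | h1
      · exact absurd (ra3 h3 ▸ h1) h.aO1
      · exact sb1 h1
    · exact sb3 h3
  subst ra sb
  obtain ⟨A', hA', Aa'⟩ := p.symm.exL h.su hK hr
  obtain ⟨B', hB', Bb'⟩ := p.symm.exL h.su hK hs
  obtain ⟨D3, hD3, D3l⟩ := p.symm.exL h.su hK hlR
  have D3a : D3 ∉ r := fun hh => nrl (p.symm.lineL h.su hK hr hlR hD3 hh D3l)
  have D3b : D3 ∉ s := fun hh => nsl (p.symm.lineL h.su hK hs hlR hD3 hh D3l)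
  have D3c : D3 ∉ c := fun hh =>
    hC.ne hK hD3 hLK (h.s23.s12.ellA e Cl D3l Cc hh)
  have mK : Miss X M K c := by
    rcases h.missOf hK hD3 D3a D3b D3c with m | m | m
    · exact absurd Aa' (m A' hA')
    · exact absurd Bb' (m B' hB')
    · exact m
  obtain ⟨L1, hL1, m1⟩ := h.exMiss
  obtain ⟨L2, hL2, m2⟩ := h.s12.exMiss
  obtain ⟨x1, x1l, hx1⟩ := e.ex h.su hL1
  obtain ⟨x2, x2l, hx2⟩ := e.ex h.su hL2
  have x1c : x1 ∉ c := fun hh => by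
    obtain rfl := h.s23.s12.ellA e Cl x1l Cc hh
    obtain rfl := hC.lineEq hL1 hx1
    exact m1 A hA Aa
  have x2c : x2 ∉ c := fun hh => by
    obtain rfl := h.s23.s12.ellA e Cl x2l Cc hh
    obtain rfl := hC.lineEq hL2 hx2
    exact m2 B hB Bb
  have x1b : x1 ∈ s := by
    by_contra hh
    exact h.s23.ellD e hL1 hK m1 mK hx1 x1c hh hD3 D3a D3b x1l D3l
  have x2a : x2 ∈ r := by
    by_contra hh
    exact h.s12.s23.ellD e hL2 hK m2 mK hx2 x2c hh hD3 D3b D3a x2l D3l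
  exact h.pap e hL1 hL2 hK m1 m2 mK hx1 x1b x1l hx2 x2a x2l hD3 D3a D3b D3l

theorem Cfg.useFull (h : Cfg n X M O1 O2 O3 a b c) {l : Set (ℝ × ℝ)} (e : Ell n X M l)
    {L K : Set (ℝ × ℝ)} {R : _} (p : Pair X M L K R) (hlR : l ∈ R) (hL : L ∈ M) (hK : K ∈ M)
    (hLK : L ≠ K) (ma : ¬ Miss X M L a) (mb : ¬ Miss X M L b) (mc : ¬ Miss X M L c) : False := by
  obtain ⟨A, B, C, hA, hB, hC, Aa, Bb, Cc, n1, n2, n3, ex⟩ := h.full hL ma mb mc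
  obtain ⟨Q, hQ, hQl⟩ := p.exL h.su hL hlR
  rcases ex Q hQ with rfl | rfl | rfl
  · exact h.s12.s23.useF e p hlR hL hK hLK hB hC hA Bb Cc Aa n3 n1.symm n2.symm hQl
  · exact h.s23.useF e p hlR hL hK hLK hA hC hB Aa Cc Bb n2 n1 n3.symm hQl
  · exact h.useF e p hlR hL hK hLK hA hB hC Aa Bb Cc n1 n2 n3 hQl

theorem Cfg.usePair (h : Cfg n X M O1 O2 O3 a b c) {l : Set (ℝ × ℝ)} (e : Ell n X M l)
    {L K : Set (ℝ × ℝ)} {R : _} (p : Pair X M L K R) (hlR : l ∈ R) (hL : L ∈ M) (hK : K ∈ M)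
    (hLK : L ≠ K) : False := by
  by_cases hf : Miss X M L a ∨ Miss X M L b ∨ Miss X M L c
  swap
  · push Not at hf
    exact h.useFull e p hlR hL hK hLK hf.1 hf.2.1 hf.2.2
  by_cases hg : Miss X M K a ∨ Miss X M K b ∨ Miss X M K c
  swap
  · push Not at hg
    exact h.useFull e p.symm hlR hK hL hLK.symm hg.1 hg.2.1 hg.2.2
  rcases hf with m | m | m <;> rcases hg with k | k | k
  · exact hLK (h.missUniq hL hK m k)
  · exact h.useSS e p hlR hL hK m k
  · exact h.s23.useSS e p hlR hL hK m k
  · exact h.useSS e p.symm hlR hK hL k m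
  · exact hLK (h.s12.missUniq hL hK m k)
  · exact h.s12.s23.useSS e p hlR hL hK m k
  · exact h.s23.useSS e p.symm hlR hK hL k m
  · exact h.s12.s23.useSS e p.symm hlR hK hL k m
  · exact hLK (h.s23.s12.missUniq hL hK m k)

theorem Cfg.unused (h : Cfg n X M O1 O2 O3 a b c) {l : Set (ℝ × ℝ)} (e : Ell n X M l)
    {A : ℝ × ℝ} (hA : A ∈ X) {F : Finset (Set (ℝ × ℝ))} (hF : Cov n X A F) (hl : l ∈ F) :
    False := by
  have hlR : l ∈ F \ M := Finset.mem_sdiff.2 ⟨hl, e.notM h.su⟩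
  by_cases h0 : P0 X M A
  · have hc := hF.res_card h.su (T := ∅) (fun K hK hA => absurd hA (h0.2 K hK))
    rw [Finset.card_empty, add_zero, Finset.card_le_one] at hc
    have key : ∀ O, P0 X M O → O ≠ A → False := by
      intro O hO hne
      obtain ⟨r, hr, hOr⟩ := hF.res h.su hO.1 hne (fun K hK hA => absurd hA (hO.2 K hK))
      rw [hc r hr l hlR] at hOr
      exact e.no0 hO hOr
    by_cases h1 : O1 = A
    · exact key O2 h.z2 (fun h2 => h.n12 (h1.trans h2.symm))
    · exact key O1 h.z1 h1
  · obtain ⟨L, hL, hAL⟩ : ∃ L ∈ M, A ∈ L := by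
      by_contra hc
      push Not at hc
      exact h0 ⟨hA, hc⟩
    by_cases h1 : ∃ K ∈ M, A ∈ K ∧ K ≠ L
    · obtain ⟨K, hK, hAK, hne⟩ := h1
      exact h.usePair e (hF.pair h.su hA hL hK hne.symm hAL hAK) hlR hL hK hne.symm
    · push Not at h1
      have hc := hF.res_card h.su (T := {L}) (fun K hK hA => by
        rw [Finset.mem_singleton]; exact h1 K hK hA)
      rw [Finset.card_singleton] at hc
      have cz : ∀ O, P0 X M O → ∃ r ∈ F \ M, O ∈ r := fun O hO =>
        hF.res h.su hO.1 (by rintro rfl; exact h0 hO) (fun K hK hA => absurd hA (hO.2 K hK))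
      obtain ⟨r, hr, h1r⟩ := cz O1 h.z1
      have nrl : r ≠ l := by
        rintro rfl
        exact e.no0 h.z1 h1r
      have key : ∀ O, P0 X M O → O ∈ r := by
        intro O hO
        obtain ⟨t, ht, hOt⟩ := cz O hO
        rcases two_of hc hr hlR nrl ht with rfl | rfl
        · exact hOt
        · exact absurd hOt (e.no0 hO)
      have := (hF.ln r (Finset.mem_sdiff.1 hr).1).eq h.la h.n23 (key O2 h.z2) (key O3 h.z3)
        h.aO2 h.aO3
      exact h.aO1 (this ▸ h1r)

end GCX

namespace GCX

theorem evalPt_form {f : Poly2} (hf : f.totalDegree ≤ 1) (A : ℝ × ℝ) :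
    evalPt f A = f.coeff (Finsupp.single 0 1) * A.1 + f.coeff (Finsupp.single 1 1) * A.2
      + f.coeff 0 := by
  have key : f = MvPolynomial.C (f.coeff (Finsupp.single 0 1)) * MvPolynomial.X 0 +
      MvPolynomial.C (f.coeff (Finsupp.single 1 1)) * MvPolynomial.X 1 +
      MvPolynomial.C (f.coeff 0) := by
    ext m
    have h01 : (Finsupp.single (0 : Fin 2) 1 : Fin 2 →₀ ℕ) ≠ Finsupp.single 1 1 := by
      intro h
      have := DFunLike.congr_fun h 0
      simp at this
    have h0 : (Finsupp.single (0 : Fin 2) 1 : Fin 2 →₀ ℕ) ≠ 0 := by simp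
    have h1 : (Finsupp.single (1 : Fin 2) 1 : Fin 2 →₀ ℕ) ≠ 0 := by simp
    simp only [MvPolynomial.coeff_add, MvPolynomial.coeff_C_mul, MvPolynomial.coeff_X,
      MvPolynomial.coeff_C]
    by_cases m0 : m = 0
    · subst m0; simp
    by_cases m1 : m = Finsupp.single 0 1
    · subst m1; simp [h01.symm, h0.symm]
    by_cases m2 : m = Finsupp.single 1 1
    · subst m2; simp [h01, h1.symm]
    have : f.coeff m = 0 := by
      by_contra hc
      have hs := MvPolynomial.le_totalDegree (MvPolynomial.mem_support_iff.2 hc)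
      have hsum : m.sum (fun _ e => e) = m 0 + m 1 := by
        rw [Finsupp.sum_fintype _ _ (by simp)]
        simp
      have e : m 0 + m 1 ≤ 1 := by omega
      have : (m 0 = 0 ∧ m 1 = 0) ∨ (m 0 = 1 ∧ m 1 = 0) ∨ (m 0 = 0 ∧ m 1 = 1) := by omega
      rcases this with ⟨u, v⟩ | ⟨u, v⟩ | ⟨u, v⟩
      · apply m0; ext i; fin_cases i <;> simp [u, v]
      · apply m1; ext i; fin_cases i <;> simp [u, v]
      · apply m2; ext i; fin_cases i <;> simp [u, v]
    rw [this, if_neg (fun h => m1 h.symm), if_neg (fun h => m2 h.symm),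
      if_neg (fun h => m0 h.symm)]
    simp
  conv_lhs => rw [key]
  simp [evalPt]

theorem isLn_zeroSet {f : Poly2} (hf : f.totalDegree = 1) : IsLn (zeroSet f) := by
  refine ⟨f.coeff (Finsupp.single 0 1), f.coeff (Finsupp.single 1 1), f.coeff 0, ?_, ?_⟩
  · by_contra hc
    push Not at hc
    have : f = MvPolynomial.C (f.coeff 0) := by
      apply MvPolynomial.funext
      intro x
      have h := evalPt_form hf.le (x 0, x 1)
      rw [hc.1, hc.2] at h
      have hx : (fun i : Fin 2 => if i = 0 then x 0 else x 1) = x := by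
        funext i; fin_cases i <;> simp
      simp only [evalPt, hx] at h
      rw [h]; simp
    rw [this, MvPolynomial.totalDegree_C] at hf
    omega
  · intro p
    show evalPt f p = 0 ↔ _
    rw [evalPt_form hf.le]

theorem exists_poly {L : Set (ℝ × ℝ)} (hL : IsLn L) :
    ∃ f : Poly2, f.totalDegree = 1 ∧ L = zeroSet f := by
  obtain ⟨a, b, c, hab, h⟩ := hL
  set f : Poly2 := MvPolynomial.C a * MvPolynomial.X 0 + MvPolynomial.C b * MvPolynomial.X 1 +
    MvPolynomial.C c with hf
  have ev : ∀ A, evalPt f A = a * A.1 + b * A.2 + c := by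
    intro A; simp [evalPt, hf]
  refine ⟨f, ?_, ?_⟩
  · apply le_antisymm
    · have t : ∀ (r : ℝ) (i : Fin 2),
          (MvPolynomial.C r * MvPolynomial.X i : Poly2).totalDegree ≤ 1 := by
        intro r i
        refine (MvPolynomial.totalDegree_mul _ _).trans ?_
        simp
      refine (MvPolynomial.totalDegree_add _ _).trans (max_le ?_ (by simp))
      exact (MvPolynomial.totalDegree_add _ _).trans (max_le (t _ _) (t _ _))
    · by_contra hc
      have h0 : f.totalDegree = 0 := by omega
      rw [MvPolynomial.totalDegree_eq_zero_iff_eq_C] at h0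
      have ev' : ∀ A, evalPt f A = f.coeff 0 := by
        intro A; conv_lhs => rw [h0]
        simp [evalPt]
      have e0 := (ev (0, 0)).symm.trans (ev' _)
      have e1 := (ev (1, 0)).symm.trans (ev' _)
      have e2 := (ev (0, 1)).symm.trans (ev' _)
      simp only at e0 e1 e2
      rcases hab with h1 | h1 <;> apply h1 <;> linarith
  · ext p
    rw [h]
    show _ ↔ evalPt f p = 0
    rw [ev]

theorem nodesOn_eq (X : Finset (ℝ × ℝ)) (f : Poly2) : nodesOn X f = on X (zeroSet f) := by
  ext A
  simp [nodesOn, mem_on, zeroSet]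

theorem max_iff {n : ℕ} {X : Finset (ℝ × ℝ)} {L : Set (ℝ × ℝ)} :
    (∃ f : Poly2, IsMaximalLine n X f ∧ L = zeroSet f) ↔ IsLn L ∧ (on X L).card = n + 1 := by
  constructor
  · rintro ⟨f, ⟨h1, h2⟩, rfl⟩
    exact ⟨isLn_zeroSet h1, by rw [← nodesOn_eq, h2]⟩
  · rintro ⟨h1, h2⟩
    obtain ⟨f, hf, rfl⟩ := exists_poly h1
    exact ⟨f, ⟨hf, by rw [nodesOn_eq, h2]⟩, rfl⟩

theorem evalPt_prod {n : ℕ} (f : Fin n → Poly2) (A : ℝ × ℝ) :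
    evalPt (∏ i, f i) A = ∏ i, evalPt (f i) A := by
  simp [evalPt, map_prod]

open Classical in
theorem cov_of_prod {n : ℕ} {X : Finset (ℝ × ℝ)} {A : ℝ × ℝ} {f : Fin n → Poly2}
    (hf : ∀ i, (f i).totalDegree = 1) (hp : IsFund n X A (∏ i, f i)) :
    Cov n X A (Finset.univ.image (fun i => zeroSet (f i))) := by
  refine ⟨?_, ?_, ?_, ?_⟩
  · exact Finset.card_image_le.trans (by simp)
  · intro L hL
    obtain ⟨i, -, rfl⟩ := Finset.mem_image.1 hL
    exact isLn_zeroSet (hf i)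
  · intro L hL hA
    obtain ⟨i, -, rfl⟩ := Finset.mem_image.1 hL
    have h1 := hp.2.1
    have hz : evalPt (f i) A = 0 := hA
    rw [evalPt_prod, Finset.prod_eq_zero (Finset.mem_univ i) hz] at h1
    exact zero_ne_one h1
  · intro B hB hne
    have h1 := hp.2.2 B hB hne
    rw [evalPt_prod, Finset.prod_eq_zero_iff] at h1
    obtain ⟨i, -, hi⟩ := h1
    exact ⟨_, Finset.mem_image_of_mem _ (Finset.mem_univ i), hi⟩

theorem exists_points {L : Set (ℝ × ℝ)} (hL : IsLn L) (k : ℕ) :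
    ∃ S : Finset (ℝ × ℝ), S.card = k ∧ ∀ B ∈ S, B ∈ L := by
  have hinf : L.Infinite := by
    obtain ⟨a, b, c, hab, h⟩ := hL
    rcases hab with h1 | h1
    · refine Set.infinite_of_injective_forall_mem (f := fun t : ℝ => ((-(b * t + c) / a, t) : ℝ × ℝ))
        (fun s t h => (Prod.mk.inj h).2) ?_
      intro t
      rw [h]
      field_simp
      ring
    · refine Set.infinite_of_injective_forall_mem (f := fun t : ℝ => ((t, -(a * t + c) / b) : ℝ × ℝ))
        (fun s t h => (Prod.mk.inj h).1) ?_
      intro t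
      rw [h]
      field_simp
      ring
  obtain ⟨S, h1, h2⟩ := hinf.exists_subset_card_eq k
  exact ⟨S, h2, fun B hB => h1 (by simpa using hB)⟩

theorem main {n : ℕ} (hn : 4 ≤ n)
    {X : Finset (ℝ × ℝ)} (hX : IsGC n X) (hmu : mu n X = n - 1)
    {ℓ : Poly2} (hℓ : IsKNodeLine X ℓ (n - 1))
    (hone : ∀ A ∈ nodesOn X ℓ,
      {L : Set (ℝ × ℝ) |
        (∃ lam : Poly2, IsMaximalLine n X lam ∧ L = zeroSet lam) ∧ A ∈ L}.ncard = 1) :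
    (n = 4 ∨ n = 5) ∧ usesSet n X ℓ = ∅ := by
  classical
  have hfin : {L : Set (ℝ × ℝ) | ∃ ℓ : Poly2, IsMaximalLine n X ℓ ∧ L = zeroSet ℓ}.Finite := by
    apply Set.finite_of_ncard_ne_zero
    unfold mu at hmu
    omega
  have hM : ∀ L, L ∈ hfin.toFinset ↔ IsLn L ∧ (on X L).card = n + 1 := by
    intro L
    rw [Set.Finite.mem_toFinset, ← max_iff]
    rfl
  have su : Su n X hfin.toFinset := by
    refine ⟨hn, ?_, hM, ?_, ?_⟩
    · intro A hA
      obtain ⟨p, hp, f, hf, rfl⟩ := hX.2 A hA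
      exact ⟨_, cov_of_prod hf hp⟩
    · rw [← Set.ncard_eq_toFinset_card _ hfin]
      exact hmu
    · rw [hX.1.1, Nat.choose_two_right]
      have h2 : 2 ∣ (n + 2) * (n + 2 - 1) := (Nat.even_mul_pred_self (n + 2)).two_dvd
      rw [Nat.mul_div_cancel' h2]
      simp
  have el : Ell n X hfin.toFinset (zeroSet ℓ) := by
    refine ⟨isLn_zeroSet hℓ.1, by rw [← nodesOn_eq, hℓ.2], ?_⟩
    intro A hA hAl
    obtain ⟨L, hL⟩ := Set.ncard_eq_one.1 (hone A (by rw [nodesOn_eq, mem_on]; exact ⟨hA, hAl⟩))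
    have h1 : L ∈ ({L} : Set (Set (ℝ × ℝ))) := rfl
    rw [← hL] at h1
    refine ⟨L, (hM L).2 (max_iff.1 h1.1), hA, h1.2, ?_⟩
    intro K hK hAK
    have h2 : K ∈ ({L} : Set (Set (ℝ × ℝ))) := by
      rw [← hL]
      exact ⟨max_iff.2 ((hM K).1 hK), hAK⟩
    exact h2
  obtain ⟨O1, O2, O3, a, b, c, cfg⟩ := su.cfg
  have h5 := cfg.le5 el
  refine ⟨by omega, ?_⟩
  apply Finset.eq_empty_of_forall_notMem
  intro A hA
  obtain ⟨hAX, q, hq, hdvd⟩ : A ∈ X ∧ Uses n X ℓ A := by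
    simpa [usesSet] using hA
  obtain ⟨p, hp, f, hf, rfl⟩ := hX.2 A hAX
  have heq : q = ∏ i, f i := by
    rw [← sub_eq_zero]
    apply hX.1.2
    · exact (MvPolynomial.totalDegree_sub _ _).trans (max_le hq.1 hp.1)
    · intro B hB
      have e : evalPt (q - ∏ i, f i) B = evalPt q B - evalPt (∏ i, f i) B := by
        simp [evalPt]
      rw [e]
      by_cases hBA : B = A
      · rw [hBA, hq.2.1, hp.2.1, sub_self]
      · rw [hq.2.2 B hB hBA, hp.2.2 B hB hBA, sub_self]
  subst heq
  have cv := cov_of_prod hf hp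
  refine cfg.unused el hAX cv ?_
  obtain ⟨S, hS, hSl⟩ := exists_points el.ln (n + 1)
  refine pig (S := S) cv.ln el.ln hSl ?_ (by have := cv.card; omega)
  intro B hB
  obtain ⟨r, hr⟩ := hdvd
  have h0 : evalPt (∏ i, f i) B = 0 := by
    have hz : evalPt ℓ B = 0 := hSl B hB
    rw [hr]
    unfold evalPt at hz ⊢
    rw [map_mul, hz, zero_mul]
  rw [evalPt_prod, Finset.prod_eq_zero_iff] at h0
  obtain ⟨i, -, hi⟩ := h0
  exact ⟨_, Finset.mem_image_of_mem _ (Finset.mem_univ i), hi⟩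

end GCX

/-- Let `X` be a `GC_n` set with exactly `n-1` maximal lines, `n ≥ 4`, and
`ℓ` an `(n-1)`-node line such that through each node of `X` on `ℓ` there passes exactly
one maximal line. Then `n = 4` or `n = 5`, and `X_ℓ = ∅`. -/
theorem stmt_10 (n : ℕ) (hn : 4 ≤ n)
    (X : Finset (ℝ × ℝ)) (hX : IsGC n X) (hmu : mu n X = n - 1)
    (ℓ : Poly2) (hℓ : IsKNodeLine X ℓ (n - 1))
    (hone : ∀ A ∈ nodesOn X ℓ,
      {L : Set (ℝ × ℝ) |
        (∃ lam : Poly2, IsMaximalLine n X lam ∧ L = zeroSet lam) ∧ A ∈ L}.ncard = 1) :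
    (n = 4 ∨ n = 5) ∧ usesSet n X ℓ = ∅ := by
  exact GCX.main hn hX hmu hℓ hone
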